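/- arXiv:1608.05157 — 5 statements merged into one kernel-verified Lean document; each statement's English description precedes it below -/
import Mathlib

section
/- Let G be a finite abelian group with exponent n = exp(G). For every integer i with 2 ≤ i ≤ ⌊n/2⌋ + 1, we have η_i(G) = η(G) + i − 1. -/
/-- The zero-sum invariant `s_L(G)`: the smallest positive integer `ℓ` such that every
sequence (multiset) over `G` of length at least `ℓ` contains a nonempty zero-sum
subsequence whose length lies in `L`. -/
noncomputable def zsInv (G : Type*) [AddCommGroup G] (L : Set ℕ) : ℕ :=
  sInf {ℓ : ℕ | 0 < ℓ ∧ ∀ S : Multiset G, ℓ ≤ Multiset.card S →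
    ∃ T : Multiset G, T ≤ S ∧ T ≠ 0 ∧ T.sum = 0 ∧ Multiset.card T ∈ L}

/-- The Davenport constant `D(G)`. -/
noncomputable def davenport (G : Type*) [AddCommGroup G] : ℕ := zsInv G {t | 0 < t}

/-- The η-invariant `η(G) = s_{[1, exp(G)]}(G)`. -/
noncomputable def etaInv (G : Type*) [AddCommGroup G] : ℕ :=
  zsInv G {t | 0 < t ∧ t ≤ AddMonoid.exponent G}

/-- The Erdős–Ginzburg–Ziv constant `s(G) = s_{{exp(G)}}(G)`. -/
noncomputable def egzConst (G : Type*) [AddCommGroup G] : ℕ :=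
  zsInv G {AddMonoid.exponent G}

/-- `η_i(G) = s_{[i, exp(G)]}(G)`. -/
noncomputable def etaI (G : Type*) [AddCommGroup G] (i : ℕ) : ℕ :=
  zsInv G {t | i ≤ t ∧ t ≤ AddMonoid.exponent G}

/-- `ζ_i(G) = s_{[i-n,0] + nℕ⁺}(G)` where `n = exp(G)`: the invariant for zero-sum
subsequences whose length is congruent mod `n` to some residue `r` with `i ≤ r ≤ n`. -/
noncomputable def zetaI (G : Type*) [AddCommGroup G] (i : ℕ) : ℕ :=
  zsInv G {t | 0 < t ∧ ∃ r : ℕ, i ≤ r ∧ r ≤ AddMonoid.exponent G ∧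
    t % AddMonoid.exponent G = r % AddMonoid.exponent G}

theorem exists_zero_sum_of_card_mul_exponent_le (G : Type*) [AddCommGroup G] [Finite G] :
    ∃ ℓ : ℕ, 0 < ℓ ∧ ∀ S : Multiset G, ℓ ≤ Multiset.card S →
      ∃ T : Multiset G, T ≤ S ∧ T ≠ 0 ∧ T.sum = 0 ∧
        Multiset.card T ∈ {t | 0 < t ∧ t ≤ AddMonoid.exponent G} := by
  classical
  have hn : 0 < AddMonoid.exponent G :=
    Nat.pos_of_ne_zero (AddMonoid.exponent_ne_zero_of_finite (G := G))
  have := Fintype.ofFinite G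
  have hG : 0 < Fintype.card G := Fintype.card_pos
  refine ⟨Fintype.card G * AddMonoid.exponent G, by positivity, fun S hS => ?_⟩
  obtain ⟨g, -, hg⟩ := Finset.exists_le_of_sum_le (s := Finset.univ)
    (f := fun _ : G => AddMonoid.exponent G) (g := fun g => S.count g)
    Finset.univ_nonempty (by simpa [Multiset.sum_count_eq_card] using hS)
  refine ⟨Multiset.replicate (AddMonoid.exponent G) g, Multiset.le_count_iff_replicate_le.1 hg,
    fun h => ?_, ?_, ?_⟩
  · have := congrArg Multiset.card h
    simp only [Multiset.card_replicate, Multiset.card_zero] at this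
    omega
  · simp [AddMonoid.exponent_nsmul_eq_zero]
  · simpa using hn

theorem etaInv_spec (G : Type*) [AddCommGroup G] [Finite G] :
    0 < etaInv G ∧ ∀ S : Multiset G, etaInv G ≤ Multiset.card S →
      ∃ T : Multiset G, T ≤ S ∧ T ≠ 0 ∧ T.sum = 0 ∧
        Multiset.card T ∈ {t | 0 < t ∧ t ≤ AddMonoid.exponent G} :=
  Nat.sInf_mem (exists_zero_sum_of_card_mul_exponent_le G)

/-- There is a sequence of length at least `η(G) - 1` without short zero-sum subsequences. -/
theorem exists_etaInv_extremal (G : Type*) [AddCommGroup G] :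
    ∃ S : Multiset G, etaInv G ≤ Multiset.card S + 1 ∧ ∀ T ≤ S, T ≠ 0 → T.sum = 0 →
      AddMonoid.exponent G < Multiset.card T := by
  rcases Nat.lt_or_ge 1 (etaInv G) with h | h
  · have hmin : etaInv G - 1 < etaInv G := by omega
    have hnot := Nat.notMem_of_lt_sInf hmin
    by_contra! hcon
    refine hnot ⟨by omega, fun S hS => ?_⟩
    obtain ⟨T, hTS, hT0, hT, hTc⟩ := hcon S (by omega)
    exact ⟨T, hTS, hT0, hT, Multiset.card_pos.2 hT0, hTc⟩
  · exact ⟨0, by simpa using h, fun T hT hT0 => absurd (Multiset.le_zero.1 hT) hT0⟩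

/-- Short zero-sum subsequences can be merged until the length reaches any `k ≤ i`. -/
theorem exists_zero_sum_card_between (G : Type*) [AddCommGroup G] [Finite G]
    {i : ℕ} (hi : i ≤ AddMonoid.exponent G / 2 + 1) (S : Multiset G)
    (hS : etaInv G + i - 1 ≤ Multiset.card S) {k : ℕ} (hk : k ≤ i) :
    ∃ T ≤ S, T.sum = 0 ∧ k ≤ Multiset.card T ∧ Multiset.card T ≤ AddMonoid.exponent G := by
  classical
  induction k with
  | zero => exact ⟨0, zero_le, by simp⟩
  | succ k ih =>
    obtain ⟨T, hTS, hT, hkT, hTn⟩ := ih (by omega)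
    clear ih
    by_cases hlt : k + 1 ≤ Multiset.card T
    · exact ⟨T, hTS, hT, hlt, hTn⟩
    have hrest : etaInv G ≤ Multiset.card (S - T) := by
      rw [Multiset.card_sub hTS]
      omega
    obtain ⟨U, hUS, hU0, hU, hUpos, hUn⟩ := (etaInv_spec G).2 (S - T) hrest
    by_cases hUi : i ≤ Multiset.card U
    · exact ⟨U, hUS.trans (Multiset.sub_le_self S T), hU, by omega, hUn⟩
    · refine ⟨T + U, ?_, by simp [hT, hU], ?_, ?_⟩
      · calc T + U ≤ T + (S - T) := by gcongr
          _ = S := add_tsub_cancel_of_le hTS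
      · rw [Multiset.card_add]; omega
      · rw [Multiset.card_add]; omega

/-- For a finite abelian group `G` with `n = exp(G)` and
`2 ≤ i ≤ ⌊n/2⌋ + 1`, we have `η_i(G) = η(G) + i − 1`. -/
theorem stmt9 (G : Type*) [AddCommGroup G] [Finite G]
    (i : ℕ) (hi1 : 2 ≤ i) (hi2 : i ≤ AddMonoid.exponent G / 2 + 1) :
    etaI G i = etaInv G + i - 1 := by
  classical
  have hpos := (etaInv_spec G).1
  have hmem : etaInv G + i - 1 ∈ {ℓ : ℕ | 0 < ℓ ∧ ∀ S : Multiset G, ℓ ≤ Multiset.card S →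
      ∃ T : Multiset G, T ≤ S ∧ T ≠ 0 ∧ T.sum = 0 ∧
        Multiset.card T ∈ {t | i ≤ t ∧ t ≤ AddMonoid.exponent G}} := by
    refine ⟨by omega, fun S hS => ?_⟩
    obtain ⟨T, hTS, hT, hiT, hTn⟩ := exists_zero_sum_card_between G hi2 S hS le_rfl
    exact ⟨T, hTS, Multiset.card_pos.1 (by omega), hT, hiT, hTn⟩
  refine le_antisymm (Nat.sInf_le hmem) (le_csInf ⟨_, hmem⟩ ?_)
  rintro ℓ ⟨-, hℓ⟩
  by_contra! hlt
  obtain ⟨S, hS, hfree⟩ := exists_etaInv_extremal G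
  set R : Multiset G := Multiset.replicate (i - 1) 0
  have hRcard : Multiset.card R = i - 1 := Multiset.card_replicate _ _
  obtain ⟨T, hTS, -, hT, hiT, hTn⟩ := hℓ (S + R) (by rw [Multiset.card_add]; omega)
  have hsplit : T - R + T ∩ R = T := Multiset.sub_add_inter T R
  have hinter : (T ∩ R).sum = 0 := Multiset.sum_eq_zero fun x hx =>
    Multiset.eq_of_mem_replicate (Multiset.mem_inter.1 hx).2
  have hcard := congrArg Multiset.card hsplit
  rw [Multiset.card_add] at hcard
  have hle := Multiset.card_le_card (Multiset.inter_le_right (s := T) (t := R))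
  have hsum : (T - R).sum = 0 := by
    rw [← hsplit, Multiset.sum_add, hinter, add_zero] at hT
    exact hT
  have := hfree (T - R) (tsub_le_iff_right.2 hTS) (Multiset.card_pos.1 (by omega)) hsum
  omega
end

section
/- Let G = C_{n₁} ⊕ C_{n₂} with 1 ≤ n₁ and n₁ dividing n₂. Then s(G) = 2n₁ + 2n₂ − 3 and η(G) = 2n₁ + n₂ − 2. -/
open Finset in
/-- An alternating sum over the subsets of `J` of a polynomial in the indicator variables vanishes
when the polynomial has total degree smaller than `#J`. -/
theorem sum_powerset_neg_one_pow_card_mul_eval {ι R : Type*} [DecidableEq ι] [CommRing R]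
    (J : Finset ι) (P : MvPolynomial ι R) (h : P.totalDegree < #J) :
    ∑ I ∈ J.powerset, (-1 : R) ^ #I * MvPolynomial.eval (fun i ↦ if i ∈ I then 1 else 0) P = 0 := by
  simp only [MvPolynomial.eval_eq, mul_sum]
  rw [sum_comm]
  refine sum_eq_zero fun d hd ↦ ?_
  obtain ⟨j, hjJ, hjd⟩ : ∃ j ∈ J, j ∉ d.support := by
    by_contra! hcon
    have h1 : #J ≤ #d.support := card_le_card hcon
    have h2 : #d.support ≤ d.sum fun _ e ↦ e := by
      rw [Finsupp.sum, card_eq_sum_ones]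
      exact sum_le_sum fun i hi ↦ Nat.one_le_iff_ne_zero.2 (Finsupp.mem_support_iff.1 hi)
    have h3 := MvPolynomial.le_totalDegree hd
    omega
  rw [← insert_erase hjJ, sum_powerset_insert (notMem_erase j J), ← sum_add_distrib]
  refine sum_eq_zero fun I hI ↦ ?_
  have hjI : j ∉ I := fun hj ↦ notMem_erase j J (mem_powerset.1 hI hj)
  have hprod : ∏ i ∈ d.support, (if i ∈ insert j I then (1 : R) else 0) ^ d i =
      ∏ i ∈ d.support, (if i ∈ I then (1 : R) else 0) ^ d i := by
    refine prod_congr rfl fun i hi ↦ ?_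
    have : i ≠ j := fun hij ↦ hjd (hij ▸ hi)
    simp [this]
  rw [card_insert_of_notMem hjI, hprod, pow_succ]
  ring

theorem MvPolynomial.totalDegree_aeval_le_natDegree {ι R : Type*} [CommRing R]
    (q : Polynomial R) (L : MvPolynomial ι R) (hL : L.totalDegree ≤ 1) :
    (Polynomial.aeval L q).totalDegree ≤ q.natDegree := by
  rw [Polynomial.aeval_eq_sum_range]
  refine totalDegree_finsetSum_le fun i hi ↦ ?_
  refine (totalDegree_smul_le _ _).trans ((totalDegree_pow _ _).trans ?_)
  have := Finset.mem_range.1 hi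
  nlinarith

open Finset in
/-- The number of zero-sum subsets of size `k`. -/
def zeroSumCount {ι G : Type*} [AddCommGroup G] [DecidableEq G] (v : ι → G) (k : ℕ)
    (J : Finset ι) : ℕ :=
  #{I ∈ J.powersetCard k | ∑ i ∈ I, v i = 0}

namespace zeroSumCount

open Finset

variable {ι : Type*}

section General

variable {G : Type*} [AddCommGroup G] [DecidableEq G] (v : ι → G)

theorem zero_left (J : Finset ι) : zeroSumCount v 0 J = 1 := by
  simp [zeroSumCount, filter_singleton]

theorem eq_zero_of_card_lt {k : ℕ} {J : Finset ι} (h : #J < k) : zeroSumCount v k J = 0 := by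
  simp [zeroSumCount, powersetCard_eq_empty.2 h]

theorem pos_iff {k : ℕ} {J : Finset ι} :
    0 < zeroSumCount v k J ↔ ∃ I ⊆ J, #I = k ∧ ∑ i ∈ I, v i = 0 := by
  simp [zeroSumCount, card_pos, Finset.Nonempty, mem_powersetCard, and_assoc]

theorem mono {k : ℕ} {J K : Finset ι} (h : J ⊆ K) : zeroSumCount v k J ≤ zeroSumCount v k K :=
  card_le_card (filter_subset_filter _ (powersetCard_mono h))

theorem sum_powersetCard [DecidableEq ι] (X : Finset ι) {k m : ℕ} (hkm : k ≤ m) :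
    ∑ J ∈ X.powersetCard m, zeroSumCount v k J =
      (#X - k).choose (m - k) * zeroSumCount v k X := by
  have h1 : ∀ J ∈ X.powersetCard m, zeroSumCount v k J =
      ∑ I ∈ X.powersetCard k with ∑ i ∈ I, v i = 0, if I ⊆ J then 1 else 0 := by
    intro J hJ
    rw [← card_filter, zeroSumCount]
    congr 1
    ext I
    have := (mem_powersetCard.1 hJ).1
    simp only [mem_filter, mem_powersetCard]
    exact ⟨fun h ↦ ⟨⟨⟨h.1.1.trans this, h.1.2⟩, h.2⟩, h.1.1⟩, fun h ↦ ⟨⟨h.2, h.1.1.2⟩, h.1.2⟩⟩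
  rw [sum_congr rfl h1, sum_comm, zeroSumCount, mul_comm, ← smul_eq_mul, ← sum_const]
  refine sum_congr rfl fun I hI ↦ ?_
  simp only [mem_filter, mem_powersetCard] at hI
  obtain ⟨⟨hIX, hIk⟩, -⟩ := hI
  rw [← card_filter, ← hIk, ← card_sdiff_of_subset hIX, ← card_powersetCard]
  refine card_bij' (fun J _ ↦ J \ I) (fun K _ ↦ K ∪ I) ?_ ?_ ?_ ?_
  · intro J hJ
    simp only [mem_filter, mem_powersetCard] at hJ ⊢
    exact ⟨sdiff_subset_sdiff hJ.1.1 le_rfl, by rw [card_sdiff_of_subset hJ.2, hJ.1.2]⟩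
  · intro K hK
    simp only [mem_filter, mem_powersetCard] at hK ⊢
    have hd : Disjoint K I := disjoint_of_subset_left hK.1 sdiff_disjoint
    refine ⟨⟨union_subset (hK.1.trans sdiff_subset) hIX, ?_⟩, subset_union_right⟩
    rw [card_union_of_disjoint hd, hK.2]
    omega
  · intro J hJ
    exact sdiff_union_of_subset (mem_filter.1 hJ).2
  · intro K hK
    have hd : Disjoint K I :=
      disjoint_of_subset_left (mem_powersetCard.1 hK).1 sdiff_disjoint
    exact union_sdiff_cancel_right hd

/-- Double counting of the pairs of disjoint zero-sum sets of sizes `k` and `l`. -/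
theorem sum_sdiff_eq_sum [DecidableEq ι] (X : Finset ι) (k l : ℕ) :
    ∑ A ∈ X.powersetCard k with ∑ i ∈ A, v i = 0, zeroSumCount v l (X \ A) =
      ∑ D ∈ X.powersetCard (k + l) with ∑ i ∈ D, v i = 0, zeroSumCount v l D := by
  simp only [zeroSumCount]
  rw [← card_sigma, ← card_sigma]
  refine card_bij' (fun x _ ↦ ⟨x.1 ∪ x.2, x.2⟩) (fun x _ ↦ ⟨x.1 \ x.2, x.2⟩) ?_ ?_ ?_ ?_
  · rintro ⟨A, B⟩ h
    simp only [mem_sigma, mem_filter, mem_powersetCard] at h ⊢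
    obtain ⟨⟨⟨hA, hAk⟩, hA0⟩, ⟨hB, hBl⟩, hB0⟩ := h
    have hd : Disjoint A B := (disjoint_of_subset_left hB sdiff_disjoint).symm
    refine ⟨⟨⟨union_subset hA (hB.trans sdiff_subset), ?_⟩, ?_⟩, ⟨subset_union_right, hBl⟩, hB0⟩
    · rw [card_union_of_disjoint hd, hAk, hBl]
    · rw [sum_union hd, hA0, hB0, add_zero]
  · rintro ⟨D, B⟩ h
    simp only [mem_sigma, mem_filter, mem_powersetCard] at h ⊢
    obtain ⟨⟨⟨hD, hDk⟩, hD0⟩, ⟨hB, hBl⟩, hB0⟩ := h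
    refine ⟨⟨⟨sdiff_subset.trans hD, ?_⟩, ?_⟩, ⟨?_, hBl⟩, hB0⟩
    · rw [card_sdiff_of_subset hB]; omega
    · rw [← sum_sdiff hB, hB0, add_zero] at hD0
      exact hD0
    · exact subset_sdiff.2 ⟨hB.trans hD, disjoint_sdiff⟩
  · rintro ⟨A, B⟩ h
    simp only [mem_sigma, mem_filter, mem_powersetCard] at h
    have hd : Disjoint A B := (disjoint_of_subset_left h.2.1.1 sdiff_disjoint).symm
    simp [union_sdiff_cancel_right hd]
  · rintro ⟨D, B⟩ h
    simp only [mem_sigma, mem_filter, mem_powersetCard] at h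
    simp [sdiff_union_of_subset h.2.1.1]

end General

variable {p : ℕ} [Fact p.Prime] (v : ι → ZMod p × ZMod p)

theorem one_sub_pow_card_sub_one (x : ZMod p) :
    1 - x ^ (p - 1) = if x = 0 then 1 else 0 := by
  split_ifs with h
  · have : p - 1 ≠ 0 := by have := (Fact.out : p.Prime).two_le; omega
    simp [h, this]
  · rw [ZMod.pow_card_sub_one_eq_one h, sub_self]

theorem sum_range_neg_one_pow_mul_eval [DecidableEq ι] (J : Finset ι) (q : Polynomial (ZMod p))
    (n : ℕ) (hq : q.natDegree + 2 * (p - 1) < #J) (hn : #J < n) :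
    ∑ k ∈ range n, (-1) ^ k * q.eval (k : ZMod p) * (zeroSumCount v k J : ZMod p) = 0 := by
  set L : (ι → ZMod p) → MvPolynomial ι (ZMod p) :=
    fun w ↦ ∑ i ∈ J, MvPolynomial.C (w i) * MvPolynomial.X i with hL
  have hLdeg : ∀ w, (L w).totalDegree ≤ 1 := fun w ↦
    MvPolynomial.totalDegree_finsetSum_le fun i _ ↦ by
      refine (MvPolynomial.totalDegree_mul _ _).trans ?_
      simp
  have hLeval : ∀ w, ∀ I ⊆ J,
      MvPolynomial.eval (fun i ↦ if i ∈ I then 1 else 0) (L w) = ∑ i ∈ I, w i := by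
    intro w I hI
    simp [hL, sum_ite_mem, inter_eq_right.2 hI]
  have hdelta : ∀ w, (1 - L w ^ (p - 1)).totalDegree ≤ p - 1 := fun w ↦ by
    refine (MvPolynomial.totalDegree_sub _ _).trans ?_
    simp only [MvPolynomial.totalDegree_one, zero_le, sup_of_le_right]
    exact (MvPolynomial.totalDegree_pow _ _).trans (by nlinarith [hLdeg w])
  set P : MvPolynomial ι (ZMod p) := Polynomial.aeval (L fun _ ↦ 1) q *
    ((1 - L (fun i ↦ (v i).1) ^ (p - 1)) * (1 - L (fun i ↦ (v i).2) ^ (p - 1))) with hP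
  have hPdeg : P.totalDegree < #J := by
    refine lt_of_le_of_lt ?_ hq
    refine (MvPolynomial.totalDegree_mul _ _).trans (add_le_add
      (MvPolynomial.totalDegree_aeval_le_natDegree q _ (hLdeg _)) ?_)
    refine (MvPolynomial.totalDegree_mul _ _).trans ?_
    linarith [hdelta fun i ↦ (v i).1, hdelta fun i ↦ (v i).2]
  have hPeval : ∀ I ⊆ J, MvPolynomial.eval (fun i ↦ if i ∈ I then 1 else 0) P =
      q.eval (#I : ZMod p) * if ∑ i ∈ I, v i = 0 then 1 else 0 := by
    intro I hI
    have h1 : MvPolynomial.eval (fun i ↦ if i ∈ I then 1 else 0)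
        (Polynomial.aeval (L fun _ ↦ 1) q) = q.eval (#I : ZMod p) := by
      rw [Polynomial.aeval_def, Polynomial.hom_eval₂, hLeval _ I hI]
      have : (MvPolynomial.eval fun i ↦ if i ∈ I then (1 : ZMod p) else 0).comp
          (algebraMap (ZMod p) (MvPolynomial ι (ZMod p))) = RingHom.id _ := by
        ext x
        simp [MvPolynomial.algebraMap_eq]
      rw [this, Polynomial.eval₂_id]
      simp
    rw [hP, map_mul, h1, map_mul, map_sub, map_sub, map_pow, map_pow, hLeval _ I hI,
      hLeval _ I hI, map_one, one_sub_pow_card_sub_one, one_sub_pow_card_sub_one]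
    simp only [Prod.ext_iff, Prod.fst_sum, Prod.snd_sum, Prod.fst_zero, Prod.snd_zero]
    split_ifs <;> simp_all
  have hmain := sum_powerset_neg_one_pow_card_mul_eval J P hPdeg
  rw [sum_powerset] at hmain
  have hsub : range (#J + 1) ⊆ range n := range_subset_range.2 hn
  rw [← hmain, ← sum_subset hsub]
  · refine sum_congr rfl fun k _ ↦ ?_
    rw [zeroSumCount, card_filter, Nat.cast_sum, mul_sum]
    refine sum_congr rfl fun I hI ↦ ?_
    obtain ⟨hIJ, rfl⟩ := mem_powersetCard.1 hI
    rw [hPeval I hIJ]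
    push_cast
    ring
  · intro k _ hk
    rw [mem_range] at hk
    rw [eq_zero_of_card_lt v (by omega)]
    simp

theorem sum_range_four_mul_of_mod {R : Type*} [AddCommMonoid R] {p r : ℕ} (hr : r < p) (F : ℕ → R)
    (hF : ∀ k, k % p ≠ r → F k = 0) :
    ∑ k ∈ range (4 * p), F k = F r + F (p + r) + F (2 * p + r) + F (3 * p + r) := by
  have key : ∀ m, ∑ k ∈ range p, F (m * p + k) = F (m * p + r) := fun m ↦ by
    refine sum_eq_single_of_mem r (mem_range.2 hr) fun k hk hkr ↦ hF _ ?_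
    rw [Nat.mul_add_mod', Nat.mod_eq_of_lt (mem_range.1 hk)]
    exact hkr
  have h0 := key 0
  have h1 := key 1
  simp only [zero_mul, zero_add, one_mul] at h0 h1
  rw [show 4 * p = p + p + p + p by ring, sum_range_add, sum_range_add, sum_range_add, h0, h1,
    show p + p + p = 3 * p by ring, show p + p = 2 * p by ring, key, key]

/-- The alternating sum of the numbers of zero-sum subsets of size congruent to `r` modulo `p`. -/
theorem sum_range_ite_natCast_eq (hp : p ≠ 2) {r : ℕ} (hr : r < p) (J : Finset ι) :
    ∑ k ∈ range (4 * p), (-1) ^ k * (if (k : ZMod p) - r = 0 then 1 else 0) *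
        (zeroSumCount v k J : ZMod p) =
      (-1) ^ r * (zeroSumCount v r J - zeroSumCount v (p + r) J + zeroSumCount v (2 * p + r) J -
        zeroSumCount v (3 * p + r) J) := by
  have hodd : (-1 : ZMod p) ^ p = -1 := ((Fact.out : p.Prime).odd_of_ne_two hp).neg_one_pow
  rw [sum_range_four_mul_of_mod hr]
  · simp only [Nat.cast_add, Nat.cast_mul, CharP.cast_eq_zero, zero_mul, zero_add, sub_self,
      ite_true, pow_add, mul_comm _ p, pow_mul, hodd]
    ring
  · intro k hk
    rw [if_neg]
    · simp
    · rw [sub_eq_zero, ZMod.natCast_eq_natCast_iff', Nat.mod_eq_of_lt hr]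
      exact hk

theorem alternating_sum_eq_zero [DecidableEq ι] (hp : p ≠ 2) {r : ℕ} (hr : r < p) (J : Finset ι)
    (h1 : 3 * p - 2 ≤ #J) (h2 : #J < 4 * p) :
    (zeroSumCount v r J - zeroSumCount v (p + r) J + zeroSumCount v (2 * p + r) J -
        zeroSumCount v (3 * p + r) J : ZMod p) = 0 := by
  have hp2 := (Fact.out : p.Prime).two_le
  have h := sum_range_neg_one_pow_mul_eval v J
    (1 - (Polynomial.X - Polynomial.C (r : ZMod p)) ^ (p - 1)) (4 * p) ?_ h2
  · simp only [Polynomial.eval_sub, Polynomial.eval_one, Polynomial.eval_pow, Polynomial.eval_X,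
      Polynomial.eval_C, one_sub_pow_card_sub_one] at h
    rw [sum_range_ite_natCast_eq v hp hr] at h
    simpa using h
  · have : (1 - (Polynomial.X - Polynomial.C (r : ZMod p)) ^ (p - 1)).natDegree ≤ p - 1 := by
      refine (Polynomial.natDegree_sub_le _ _).trans ?_
      simp only [Polynomial.natDegree_one, Polynomial.natDegree_pow,
        Polynomial.natDegree_X_sub_C, mul_one, zero_le, sup_of_le_right, le_refl]
    omega

theorem two_mul_eq_neg_one [DecidableEq ι] (hp : p ≠ 2) {J : Finset ι}
    (h1 : 3 * p - 2 ≤ #J) (h2 : #J < 3 * p) (h0 : zeroSumCount v p J = 0) :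
    (zeroSumCount v (2 * p) J : ZMod p) = -1 := by
  have := alternating_sum_eq_zero v hp (Fact.out : p.Prime).pos J h1 (by omega)
  simp only [add_zero, zero_left, h0, eq_zero_of_card_lt v h2] at this
  push_cast at this
  linear_combination this

theorem of_card_eq_three_mul_sub_three [DecidableEq ι] (hp : p ≠ 2) {J : Finset ι}
    (hJ : #J = 3 * p - 3) :
    (1 - zeroSumCount v (p - 1) J - zeroSumCount v p J + zeroSumCount v (2 * p - 1) J +
      zeroSumCount v (2 * p) J : ZMod p) = 0 := by
  have hp2 := (Fact.out : p.Prime).two_le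
  set m := p - 1 with hm
  have hmp : m + 1 = p := by omega
  have hcast : (m : ZMod p) = -1 := by
    rw [eq_neg_iff_add_eq_zero, ← Nat.cast_one, ← Nat.cast_add, hmp, CharP.cast_eq_zero]
  have h := sum_range_neg_one_pow_mul_eval v J
    ((1 - Polynomial.X ^ m) - (1 - (Polynomial.X - Polynomial.C (m : ZMod p)) ^ m)) (4 * p) ?_
    (by omega)
  · simp only [Polynomial.eval_sub, Polynomial.eval_one, Polynomial.eval_pow, Polynomial.eval_X,
      Polynomial.eval_C, hm, one_sub_pow_card_sub_one] at h
    simp only [← hm, mul_sub, sub_mul, sum_sub_distrib] at h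
    have e0 := sum_range_ite_natCast_eq v hp (Fact.out : p.Prime).pos J
    have e1 := sum_range_ite_natCast_eq v hp (show m < p by omega) J
    simp only [Nat.cast_zero, sub_zero] at e0
    rw [e0, e1] at h
    have hev : (-1 : ZMod p) ^ m = 1 :=
      ((Fact.out : p.Prime).even_sub_one hp).neg_one_pow
    rw [hev] at h
    simp only [pow_zero, add_zero, zero_left,
      eq_zero_of_card_lt v (show #J < 3 * p by omega),
      eq_zero_of_card_lt v (show #J < 3 * p + m by omega),
      eq_zero_of_card_lt v (show #J < 2 * p + m by omega),
      show p + m = 2 * p - 1 by omega] at h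
    push_cast at h
    linear_combination h
  · have : ((1 - Polynomial.X ^ m) -
        (1 - (Polynomial.X - Polynomial.C (m : ZMod p)) ^ m)).natDegree < m := by
      rw [sub_sub_sub_cancel_left]
      have hmon : ((Polynomial.X - Polynomial.C (m : ZMod p)) ^ m).Monic :=
        (Polynomial.monic_X_sub_C _).pow m
      have hd : ((Polynomial.X - Polynomial.C (m : ZMod p)) ^ m).degree = (m : WithBot ℕ) := by
        rw [Polynomial.degree_pow, Polynomial.degree_X_sub_C, nsmul_one]
      have hlt := Polynomial.degree_sub_lt_left (q := Polynomial.X ^ m) ?_ hmon.ne_zero ?_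
      · rw [hd] at hlt
        by_cases h0 : (Polynomial.X - Polynomial.C (m : ZMod p)) ^ m - Polynomial.X ^ m = 0
        · rw [h0, Polynomial.natDegree_zero]
          omega
        · exact (Polynomial.natDegree_lt_iff_degree_lt h0).2 hlt
      · rw [hd]; simp
      · rw [hmon.leadingCoeff]; simp
    omega

theorem of_card_eq_four_mul_sub_three [DecidableEq ι] (hp : p ≠ 2) {X : Finset ι}
    (hX : #X = 4 * p - 3) :
    (3 - 2 * zeroSumCount v (p - 1) X - 2 * zeroSumCount v p X + zeroSumCount v (2 * p - 1) X +
      zeroSumCount v (2 * p) X : ZMod p) = 0 := by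
  have hp2 := (Fact.out : p.Prime).two_le
  have hp3 : 3 ≤ p := by omega
  have hchoose : ∀ n d : ℕ, d * p ≤ n → n < (d + 1) * p → (n.choose p : ZMod p) = d := by
    intro n d h1 h2
    have h := (Choose.choose_modEq_choose_mod_mul_choose_div_nat (n := n) (k := p) (p := p))
    rw [← ZMod.natCast_eq_natCast_iff] at h
    rw [h, Nat.mod_self, Nat.div_self (by omega), Nat.choose_zero_right, Nat.choose_one_right,
      one_mul, Nat.div_eq_of_lt_le h1 h2]
  have hterm : ∀ k d : ℕ, k ≤ 3 * p - 3 → d * p ≤ 4 * p - 3 - k → 4 * p - 3 - k < (d + 1) * p →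
      ∑ J ∈ X.powersetCard (3 * p - 3), (zeroSumCount v k J : ZMod p) =
        d * zeroSumCount v k X := by
    intro k d hk h1 h2
    rw [← Nat.cast_sum, sum_powersetCard v X hk, hX, Nat.cast_mul, ← hchoose _ d h1 h2,
      ← Nat.choose_symm (show p ≤ 4 * p - 3 - k by omega)]
    congr 3
    omega
  have h : ∑ J ∈ X.powersetCard (3 * p - 3), (zeroSumCount v 0 J - zeroSumCount v (p - 1) J -
      zeroSumCount v p J + zeroSumCount v (2 * p - 1) J + zeroSumCount v (2 * p) J : ZMod p) = 0 :=
    sum_eq_zero fun J hJ ↦ by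
      rw [zero_left, Nat.cast_one]
      exact of_card_eq_three_mul_sub_three v hp (mem_powersetCard.1 hJ).2
  rw [sum_add_distrib, sum_add_distrib, sum_sub_distrib, sum_sub_distrib,
    hterm 0 3 (by omega) (by omega) (by omega), hterm (p - 1) 2 (by omega) (by omega) (by omega),
    hterm p 2 (by omega) (by omega) (by omega),
    hterm (2 * p - 1) 1 (by omega) (by omega) (by omega),
    hterm (2 * p) 1 (by omega) (by omega) (by omega), zero_left] at h
  push_cast at h
  linear_combination h

theorem pos_of_card_eq_three_mul [DecidableEq ι] (hp : p ≠ 2) {J : Finset ι} (hJ : #J = 3 * p)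
    (h0 : ∑ i ∈ J, v i = 0) : 0 < zeroSumCount v p J := by
  have hp2 := (Fact.out : p.Prime).two_le
  by_contra hcon
  have hz : zeroSumCount v p J = 0 := by omega
  obtain ⟨x, hx⟩ : J.Nonempty := card_pos.1 (by omega)
  have hc : #(J.erase x) = 3 * p - 1 := by rw [card_erase_of_mem hx, hJ]
  have hz' : zeroSumCount v p (J.erase x) = 0 :=
    Nat.le_zero.1 (hz ▸ mono v (erase_subset x J))
  have h := two_mul_eq_neg_one v hp (by omega) (by omega) hz'
  have hpos : 0 < zeroSumCount v (2 * p) (J.erase x) := by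
    rw [Nat.pos_iff_ne_zero]
    intro h'
    rw [h'] at h
    simp at h
  obtain ⟨I, hI, hIc, hIs⟩ := (pos_iff v).1 hpos
  have hIJ : I ⊆ J := hI.trans (erase_subset x J)
  refine hcon ((pos_iff v).2 ⟨J \ I, sdiff_subset, ?_, ?_⟩)
  · rw [card_sdiff_of_subset hIJ]; omega
  · rw [← sum_sdiff hIJ, hIs, add_zero] at h0
    exact h0

theorem natCast_sub_one_eq_natCast [DecidableEq ι] (hp : p ≠ 2) {X : Finset ι}
    (hX : #X = 4 * p - 3) (h0 : zeroSumCount v p X = 0) :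
    (zeroSumCount v (p - 1) X : ZMod p) = zeroSumCount v (3 * p - 1) X := by
  have hp2 := (Fact.out : p.Prime).two_le
  have hz : ∀ Y ⊆ X, zeroSumCount v p Y = 0 := fun Y hY ↦ Nat.le_zero.1 (h0 ▸ mono v hY)
  have h := congrArg (Nat.cast : ℕ → ZMod p) (sum_sdiff_eq_sum v X (p - 1) (2 * p))
  push_cast at h
  rw [show p - 1 + 2 * p = 3 * p - 1 by omega] at h
  have hA : ∀ A ∈ {A ∈ X.powersetCard (p - 1) | ∑ i ∈ A, v i = 0},
      (zeroSumCount v (2 * p) (X \ A) : ZMod p) = -1 := by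
    intro A hA
    simp only [mem_filter, mem_powersetCard] at hA
    have := card_sdiff_of_subset hA.1.1
    exact two_mul_eq_neg_one v hp (by omega) (by omega) (hz _ sdiff_subset)
  have hD : ∀ D ∈ {D ∈ X.powersetCard (3 * p - 1) | ∑ i ∈ D, v i = 0},
      (zeroSumCount v (2 * p) D : ZMod p) = -1 := by
    intro D hD
    simp only [mem_filter, mem_powersetCard] at hD
    exact two_mul_eq_neg_one v hp (by omega) (by omega) (hz D hD.1.1)
  rw [sum_congr rfl hA, sum_congr rfl hD, sum_const, sum_const] at h
  simpa [zeroSumCount] using h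

/-- Reiher's theorem, the Kemnitz conjecture for primes. -/
theorem pos_of_card_eq_four_mul_sub_three [DecidableEq ι] {X : Finset ι} (hX : #X = 4 * p - 3) :
    0 < zeroSumCount v p X := by
  have hp2 := (Fact.out : p.Prime).two_le
  by_cases hp : p = 2
  · subst hp
    obtain ⟨i, hi, j, hj, hij, hv⟩ := exists_ne_map_eq_of_card_lt_of_maps_to
      (s := X) (t := (univ : Finset (ZMod 2 × ZMod 2))) (f := v)
      (by rw [hX]; decide) (fun _ _ ↦ by simp)
    refine (pos_iff v).2 ⟨{i, j}, by simp [insert_subset_iff, hi, hj], card_pair hij, ?_⟩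
    rw [sum_pair hij, hv]
    ext <;> exact CharTwo.add_self_eq_zero _
  by_contra hcon
  have hz : zeroSumCount v p X = 0 := by omega
  have hz3 : zeroSumCount v (3 * p) X = 0 := by
    by_contra h3
    obtain ⟨I, hI, hIc, hIs⟩ := (pos_iff v).1 (Nat.pos_of_ne_zero h3)
    exact hcon ((pos_of_card_eq_three_mul v hp hIc hIs).trans_le (mono v hI))
  have e0 := alternating_sum_eq_zero v hp (show 0 < p by omega) X (by omega) (by omega)
  have e1 := alternating_sum_eq_zero v hp (show p - 1 < p by omega) X (by omega) (by omega)
  have e2 := of_card_eq_four_mul_sub_three v hp hX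
  have e3 := natCast_sub_one_eq_natCast v hp hX hz
  rw [eq_zero_of_card_lt v (show #X < 3 * p + (p - 1) by omega),
    show p + (p - 1) = 2 * p - 1 by omega, show 2 * p + (p - 1) = 3 * p - 1 by omega] at e1
  simp only [add_zero, hz, hz3, zero_left] at e0 e2
  push_cast at e0 e1 e2
  have htwo : ((2 : ℕ) : ZMod p) = 0 := by
    push_cast
    linear_combination -e0 + e1 + e2 + e3
  rw [ZMod.natCast_eq_zero_iff] at htwo
  exact hp ((Nat.prime_dvd_prime_iff_eq Fact.out Nat.prime_two).1 htwo)

end zeroSumCount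

open Finset in
/-- Greedy extraction of pairwise disjoint subsets of size `p` with a given property. -/
theorem exists_pairwiseDisjoint_subsets {ι : Type*} [DecidableEq ι] {p M : ℕ} (hp : 0 < p)
    (Q : Finset ι → Prop) (X : Finset ι)
    (hQ : ∀ Y ⊆ X, M ≤ #Y → ∃ T ⊆ Y, #T = p ∧ Q T) (t : ℕ) (ht : t * p + M ≤ #X + p) :
    ∃ 𝒯 : Finset (Finset ι), #𝒯 = t ∧ (𝒯 : Set (Finset ι)).PairwiseDisjoint id ∧
      ∀ T ∈ 𝒯, T ⊆ X ∧ #T = p ∧ Q T := by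
  induction t with
  | zero => exact ⟨∅, by simp⟩
  | succ t ih =>
    rw [add_mul, one_mul] at ht
    obtain ⟨𝒯, hcard, hdisj, h𝒯⟩ := ih (by omega)
    have hU : #(𝒯.biUnion id) = t * p := by
      rw [card_biUnion hdisj, ← hcard]
      exact sum_const_nat fun T hT ↦ (h𝒯 T hT).2.1
    have hUX : 𝒯.biUnion id ⊆ X := biUnion_subset.2 fun T hT ↦ (h𝒯 T hT).1
    obtain ⟨T, hT, hTp, hTQ⟩ := hQ (X \ 𝒯.biUnion id) sdiff_subset
      (by rw [card_sdiff_of_subset hUX]; omega)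
    have hTd : ∀ T' ∈ 𝒯, Disjoint T T' := fun T' hT' ↦
      disjoint_of_subset_left hT
        (disjoint_of_subset_right (subset_biUnion_of_mem id hT') sdiff_disjoint)
    have hTn : T ∉ 𝒯 := fun h ↦ by
      have := disjoint_self.1 (hTd T h)
      rw [this] at hTp
      simp at hTp
      omega
    refine ⟨insert T 𝒯, by rw [card_insert_of_notMem hTn, hcard], ?_, ?_⟩
    · rw [coe_insert]
      exact hdisj.insert fun T' hT' _ ↦ hTd T' hT'
    · intro T' hT'
      rcases mem_insert.1 hT' with rfl | h
      · exact ⟨hT.trans sdiff_subset, hTp, hTQ⟩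
      · exact h𝒯 T' h

open Finset in
/-- Reiher's theorem for pairs of integers. -/
theorem Int.exists_subset_card_eq_prime_dvd_sum {ι : Type*} {p : ℕ} (hp : p.Prime) (X : Finset ι)
    (v w : ι → ℤ) (hX : 4 * p - 3 ≤ #X) :
    ∃ T ⊆ X, #T = p ∧ (p : ℤ) ∣ ∑ i ∈ T, v i ∧ (p : ℤ) ∣ ∑ i ∈ T, w i := by
  classical
  have : Fact p.Prime := ⟨hp⟩
  obtain ⟨Y, hYX, hY⟩ := exists_subset_card_eq hX
  obtain ⟨T, hT, hTc, hTs⟩ := (zeroSumCount.pos_iff _).1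
    (zeroSumCount.pos_of_card_eq_four_mul_sub_three
      (fun i ↦ ((v i : ZMod p), (w i : ZMod p))) hY)
  simp only [Prod.ext_iff, Prod.fst_sum, Prod.snd_sum, Prod.fst_zero, Prod.snd_zero,
    ← Int.cast_sum, ZMod.intCast_zmod_eq_zero_iff_dvd] at hTs
  exact ⟨T, hT.trans hYX, hTc, hTs⟩

open Finset in
/-- The Erdős–Ginzburg–Ziv theorem in rank two, for pairs of integers. -/
theorem Int.exists_subset_card_eq_dvd_sum.{u} {n₁ k : ℕ} (h₁ : 0 < n₁) (hk : 0 < k) :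
    ∀ {ι : Type u} (X : Finset ι) (v w : ι → ℤ), 2 * n₁ + 2 * (n₁ * k) - 3 ≤ #X →
      ∃ T ⊆ X, #T = n₁ * k ∧ (n₁ : ℤ) ∣ ∑ i ∈ T, v i ∧ ((n₁ * k : ℕ) : ℤ) ∣ ∑ i ∈ T, w i := by
  classical
  induction n₁ using induction_on_primes with
  | zero => omega
  | one =>
    intro ι X v w hX
    obtain ⟨T, hT, hTc, hTw⟩ := Int.erdos_ginzburg_ziv (n := 1 * k) w (s := X) (by omega)
    exact ⟨T, hT, hTc, by simp, hTw⟩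
  | prime_mul p a hp ih =>
    intro ι X v w hX
    have ha : 0 < a := Nat.pos_of_mul_pos_left h₁
    have hak : 0 < a * k := Nat.mul_pos ha hk
    obtain ⟨𝒯, hcard, hdisj, h𝒯⟩ := exists_pairwiseDisjoint_subsets (M := 4 * p - 3) hp.pos
      (fun T ↦ (p : ℤ) ∣ ∑ i ∈ T, v i ∧ (p : ℤ) ∣ ∑ i ∈ T, w i) X
      (fun Y _ hY ↦ Int.exists_subset_card_eq_prime_dvd_sum hp Y v w hY)
      (2 * a + 2 * (a * k) - 3) (by
        have hp2 := hp.two_le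
        obtain ⟨t, ht⟩ : ∃ t, 2 * a + 2 * (a * k) = t + 3 := ⟨2 * a + 2 * (a * k) - 3, by omega⟩
        have hm : 2 * (p * a) + 2 * (p * a * k) = t * p + 3 * p := by
          rw [← add_mul, ← ht]; ring
        rw [ht, Nat.add_sub_cancel]
        omega)
    obtain ⟨𝒰, h𝒰, h𝒰c, hv, hw⟩ := ih ha 𝒯 (fun T ↦ (∑ i ∈ T, v i) / p)
      (fun T ↦ (∑ i ∈ T, w i) / p) hcard.ge
    have hd : (𝒰 : Set (Finset ι)).PairwiseDisjoint id := hdisj.subset (coe_subset.2 h𝒰)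
    have hsum : ∀ u : ι → ℤ, (∀ T ∈ 𝒰, (p : ℤ) ∣ ∑ i ∈ T, u i) →
        ∑ i ∈ 𝒰.biUnion id, u i = p * ∑ T ∈ 𝒰, (∑ i ∈ T, u i) / p := fun u hu ↦ by
      rw [sum_biUnion hd, mul_sum]
      exact sum_congr rfl fun T hT ↦ (Int.mul_ediv_cancel' (hu T hT)).symm
    refine ⟨𝒰.biUnion id, biUnion_subset.2 fun T hT ↦ (h𝒯 T (h𝒰 hT)).1, ?_, ?_, ?_⟩
    · have hc : ∑ T ∈ 𝒰, #(id T) = #𝒰 * p := sum_const_nat fun T hT ↦ (h𝒯 T (h𝒰 hT)).2.1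
      rw [card_biUnion hd, hc, h𝒰c]
      ring
    · rw [hsum v fun T hT ↦ (h𝒯 T (h𝒰 hT)).2.2.1]
      push_cast
      exact mul_dvd_mul_left _ hv
    · rw [hsum w fun T hT ↦ (h𝒯 T (h𝒰 hT)).2.2.2, mul_assoc, Nat.cast_mul]
      exact mul_dvd_mul_left _ hw

theorem ZMod.exists_le_card_eq_sum_eq_zero {n₁ n₂ : ℕ} (h₁ : 1 ≤ n₁) (h₂ : 1 ≤ n₂)
    (hdvd : n₁ ∣ n₂) (S : Multiset (ZMod n₁ × ZMod n₂))
    (hS : 2 * n₁ + 2 * n₂ - 3 ≤ Multiset.card S) :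
    ∃ T ≤ S, T.sum = 0 ∧ Multiset.card T = n₂ := by
  classical
  obtain ⟨k, rfl⟩ := hdvd
  obtain ⟨T, hT, hTc, hv, hw⟩ := Int.exists_subset_card_eq_dvd_sum h₁
    (Nat.pos_of_mul_pos_left h₂) S.toEnumFinset (fun x ↦ (x.1.1.cast : ℤ))
    (fun x ↦ (x.1.2.cast : ℤ)) (by simpa using hS)
  refine ⟨T.1.map Prod.fst, Multiset.map_fst_le_of_subset_toEnumFinset hT, ?_, by simpa using hTc⟩
  rw [← ZMod.intCast_zmod_eq_zero_iff_dvd, Int.cast_sum] at hv hw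
  simp only [ZMod.intCast_cast, ZMod.cast_id', id_eq] at hv hw
  change ∑ x ∈ T, x.1 = 0
  ext
  · rw [Prod.fst_sum, hv, Prod.fst_zero]
  · rw [Prod.snd_sum, hw, Prod.snd_zero]

/-- An extremal sequence without short zero-sum subsequence. -/
theorem ZMod.exists_card_eq_forall_sum_ne_zero {n₁ n₂ : ℕ} (h₁ : 1 ≤ n₁) (h₂ : 1 ≤ n₂)
    (hdvd : n₁ ∣ n₂) :
    ∃ S : Multiset (ZMod n₁ × ZMod n₂), Multiset.card S = 2 * n₁ + n₂ - 3 ∧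
      ∀ T ≤ S, T ≠ 0 → Multiset.card T ≤ n₂ → T.sum ≠ 0 := by
  classical
  refine ⟨Multiset.replicate (n₂ - 1) (0, 1) + (Multiset.replicate (n₁ - 1) (1, 0) +
    Multiset.replicate (n₁ - 1) (1, 1)), ?_, ?_⟩
  · simp only [Multiset.card_add, Multiset.card_replicate]
    omega
  intro T hT hT0 hTc hTs
  have split : ∀ U A B : Multiset (ZMod n₁ × ZMod n₂), U ≤ A + B → ∃ A' ≤ A, ∃ B' ≤ B,
      U = A' + B' := fun U A B h ↦
    ⟨U ∩ A, Multiset.inter_le_right, U - A, by rwa [tsub_le_iff_left], by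
      rw [add_comm, Multiset.sub_add_inter]⟩
  obtain ⟨A, hA, U, hU, rfl⟩ := split _ _ _ hT
  obtain ⟨B, hB, C, hC, rfl⟩ := split _ _ _ hU
  obtain ⟨a, ha, rfl⟩ := Multiset.le_replicate_iff.1 hA
  obtain ⟨b, hb, rfl⟩ := Multiset.le_replicate_iff.1 hB
  obtain ⟨c, hc, rfl⟩ := Multiset.le_replicate_iff.1 hC
  simp only [Multiset.card_add, Multiset.card_replicate] at hTc
  simp only [Multiset.sum_add, Multiset.sum_replicate, Prod.smul_mk, Prod.mk_add_mk, smul_zero,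
    nsmul_one, zero_add, Prod.mk_eq_zero, ← Nat.cast_add, ZMod.natCast_eq_zero_iff] at hTs
  obtain ⟨⟨x, hx⟩, y, hy⟩ := hTs
  have hx2 : x < 2 := by
    by_contra! h
    have := Nat.mul_le_mul_left n₁ h
    omega
  have hn := Nat.le_of_dvd h₂ hdvd
  have hy2 : y < 2 := by
    by_contra! h
    have := Nat.mul_le_mul_left n₂ h
    omega
  have hne : a + b + c ≠ 0 := fun h ↦ hT0 (by
    obtain ⟨rfl, rfl, rfl⟩ : a = 0 ∧ b = 0 ∧ c = 0 := by omega
    simp)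
  interval_cases x <;> interval_cases y <;> omega

theorem zsInv_eq_of_forall_of_exists {G : Type*} [AddCommGroup G] {L : Set ℕ} {l : ℕ} (hl : 0 < l)
    (h : ∀ S : Multiset G, l ≤ Multiset.card S →
      ∃ T ≤ S, T ≠ 0 ∧ T.sum = 0 ∧ Multiset.card T ∈ L)
    (h' : ∃ S : Multiset G, Multiset.card S = l - 1 ∧
      ∀ T ≤ S, T ≠ 0 → Multiset.card T ∈ L → T.sum ≠ 0) : zsInv G L = l := by
  have hmem : l ∈ {l : ℕ | 0 < l ∧ ∀ S : Multiset G, l ≤ Multiset.card S →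
      ∃ T : Multiset G, T ≤ S ∧ T ≠ 0 ∧ T.sum = 0 ∧ Multiset.card T ∈ L} := ⟨hl, h⟩
  refine le_antisymm (Nat.sInf_le hmem) (le_csInf ⟨l, hmem⟩ ?_)
  rintro m ⟨-, hm⟩
  by_contra! hlt
  obtain ⟨S, hS, hS'⟩ := h'
  obtain ⟨T, hTS, hT0, hTs, hTL⟩ := hm S (by omega)
  exact hS' T hTS hT0 hTL hTs

/-- Adjoining zeros: a subsequence of `S` and `m` zeros restricts to a subsequence of `S`. -/
theorem Multiset.exists_le_of_le_add_replicate_zero {G : Type*} [AddCommMonoid G]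
    {S T : Multiset G} {m : ℕ} (h : T ≤ S + replicate m 0) :
    ∃ U ≤ S, U.sum = T.sum ∧ card U ≤ card T ∧ card T ≤ card U + m := by
  classical
  have hT : T - replicate m 0 + T ∩ replicate m 0 = T := sub_add_inter _ _
  obtain ⟨k, hk, hk'⟩ := le_replicate_iff.1 (inter_le_right : T ∩ replicate m (0 : G) ≤ _)
  rw [hk'] at hT
  refine ⟨T - replicate m 0, by rwa [tsub_le_iff_right], ?_, ?_, ?_⟩
  · conv_rhs => rw [← hT]
    simp
  · conv_rhs => rw [← hT]
    simp
  · conv_lhs => rw [← hT]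
    simpa using hk

/-- For `G = C_{n₁} ⊕ C_{n₂}` with `1 ≤ n₁ ∣ n₂`, we have
`s(G) = 2n₁ + 2n₂ − 3` and `η(G) = 2n₁ + n₂ − 2`. -/
theorem stmt10 (n₁ n₂ : ℕ) (h₁ : 1 ≤ n₁) (h₂ : 1 ≤ n₂) (hdvd : n₁ ∣ n₂) :
    egzConst (ZMod n₁ × ZMod n₂) = 2 * n₁ + 2 * n₂ - 3 ∧
      etaInv (ZMod n₁ × ZMod n₂) = 2 * n₁ + n₂ - 2 := by
  have hexp : AddMonoid.exponent (ZMod n₁ × ZMod n₂) = n₂ := by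
    rw [AddMonoid.exponent_prod, ZMod.exponent, ZMod.exponent]
    exact Nat.lcm_eq_right hdvd
  obtain ⟨S₀, hS₀, hS₀'⟩ := ZMod.exists_card_eq_forall_sum_ne_zero h₁ h₂ hdvd
  constructor
  · refine zsInv_eq_of_forall_of_exists (by omega) (fun S hS ↦ ?_)
      ⟨S₀ + Multiset.replicate (n₂ - 1) 0, ?_, fun T hT _ hTc hTs ↦ ?_⟩
    · obtain ⟨T, hT, hTs, hTc⟩ := ZMod.exists_le_card_eq_sum_eq_zero h₁ h₂ hdvd S hS
      refine ⟨T, hT, ?_, hTs, by simp [hexp, hTc]⟩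
      rintro rfl
      simp at hTc
      omega
    · rw [Multiset.card_add, Multiset.card_replicate, hS₀]
      omega
    · rw [hexp, Set.mem_singleton_iff] at hTc
      obtain ⟨U, hU, hUs, hUc, hUc'⟩ := Multiset.exists_le_of_le_add_replicate_zero hT
      refine hS₀' U hU ?_ (hUc.trans hTc.le) (hUs.trans hTs)
      rintro rfl
      simp only [Multiset.card_zero] at hUc'
      omega
  · refine zsInv_eq_of_forall_of_exists (by omega) (fun S hS ↦ ?_)
      ⟨S₀, by omega, fun T hT hT0 hTc ↦ hS₀' T hT hT0 (hTc.2.trans hexp.le)⟩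
    obtain ⟨T, hT, hTs, hTc⟩ := ZMod.exists_le_card_eq_sum_eq_zero h₁ h₂ hdvd
      (S + Multiset.replicate (n₂ - 1) 0) (by
        rw [Multiset.card_add, Multiset.card_replicate]
        omega)
    obtain ⟨U, hU, hUs, hUc, hUc'⟩ := Multiset.exists_le_of_le_add_replicate_zero hT
    refine ⟨U, hU, ?_, hUs.trans hTs, ?_, by rw [hexp]; omega⟩
    · rintro rfl
      simp only [Multiset.card_zero] at hUc'
      omega
    · omega
end

section
/- Let p be an odd prime and let G be a finite abelian p-group with Davenport constant D(G) ≤ 2·exp(G) − 1. Then 2·D(G) − 1 ≤ η(G) + exp(G) − 1 ≤ s(G) ≤ D(G) + 2·exp(G) − 2. -/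
namespace ZeroSum

open Finset

theorem ideal_sup_pow_le {R : Type*} [CommRing R] (I J : Ideal R) (a b : ℕ) :
    (I ⊔ J) ^ (a + b + 1) ≤ I ^ (a + 1) ⊔ J ^ (b + 1) := by
  rw [← Submodule.add_eq_sup, add_pow]
  refine Finset.sum_induction _ (fun K => K ≤ I ^ (a + 1) ⊔ J ^ (b + 1))
    (fun K L hK hL => sup_le hK hL) bot_le fun m hm => ?_
  have h₁ : I ^ m * J ^ (a + b + 1 - m) * (((a + b + 1).choose m : ℕ) : Ideal R) ≤
      I ^ m * J ^ (a + b + 1 - m) := Ideal.mul_le_left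
  refine h₁.trans ?_
  rcases le_or_gt (a + 1) m with h | h
  · have h₂ : I ^ m ≤ I ^ (a + 1) := Ideal.pow_le_pow_right h
    exact Ideal.mul_le_left.trans (h₂.trans le_sup_left)
  · have h₂ : J ^ (a + b + 1 - m) ≤ J ^ (b + 1) := Ideal.pow_le_pow_right (by omega)
    exact Ideal.mul_le_right.trans (h₂.trans le_sup_right)

theorem ideal_span_pow_eq_bot {R κ : Type*} [CommRing R] (s : Finset κ) (y : κ → R)
    (n : κ → ℕ) (hn : ∀ j, 0 < n j) (hy : ∀ j, y j ^ n j = 0) :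
    (⨆ j ∈ s, Ideal.span {y j}) ^ (∑ j ∈ s, (n j - 1) + 1) = ⊥ := by
  classical
  induction s using Finset.induction_on with
  | empty => simp
  | insert j s hj ih =>
    rw [Finset.iSup_insert, Finset.sum_insert hj, eq_bot_iff]
    refine (ideal_sup_pow_le _ _ _ _).trans ?_
    rw [ih, Nat.sub_add_cancel (hn j), Ideal.span_singleton_pow, hy]
    simp

theorem one_sub_single_mem {K A : Type*} [CommRing K] [AddCommGroup A]
    (I : Ideal (AddMonoidAlgebra K A)) {s : Set A} (hs : AddSubgroup.closure s = ⊤)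
    (hI : ∀ a ∈ s, 1 - AddMonoidAlgebra.single a 1 ∈ I) (a : A) :
    1 - AddMonoidAlgebra.single a 1 ∈ I := by
  have ha : a ∈ AddSubgroup.closure s := by rw [hs]; trivial
  induction ha using AddSubgroup.closure_induction with
  | mem x hx => exact hI x hx
  | zero => simp [← AddMonoidAlgebra.one_def]
  | add x y _ _ hx hy =>
    have : (1 : AddMonoidAlgebra K A) - AddMonoidAlgebra.single (x + y) 1 =
        (1 - AddMonoidAlgebra.single x 1) +
          AddMonoidAlgebra.single x 1 * (1 - AddMonoidAlgebra.single y 1) := by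
      rw [mul_sub, AddMonoidAlgebra.single_mul_single]
      simp
    rw [this]
    exact I.add_mem hx (I.mul_mem_left _ hy)
  | neg x _ hx =>
    have : (1 : AddMonoidAlgebra K A) - AddMonoidAlgebra.single (-x) 1 =
        -AddMonoidAlgebra.single (-x) 1 * (1 - AddMonoidAlgebra.single x 1) := by
      rw [neg_mul, mul_sub, AddMonoidAlgebra.single_mul_single]
      simp [← AddMonoidAlgebra.one_def]
    rw [this]
    exact I.mul_mem_left _ hx

/-- Every product of more than `M` elements `1 - X ^ a` of the group algebra of `A` over
`ZMod p` vanishes. -/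
def AugmentationNilpotent (p : ℕ) (A : Type*) [AddCommGroup A] (M : ℕ) : Prop :=
  ∀ s : Multiset A, M < Multiset.card s →
    (s.map fun a => (1 - AddMonoidAlgebra.single a 1 : AddMonoidAlgebra (ZMod p) A)).prod = 0

/-- Olson's theorem on the augmentation ideal of the group algebra of a finite abelian
`p`-group over `ZMod p`. -/
theorem augmentationNilpotent_of_closure {p : ℕ} [Fact p.Prime] {A κ : Type*} [AddCommGroup A]
    [Fintype κ] (e : κ → A) (he : AddSubgroup.closure (Set.range e) = ⊤) (n : κ → ℕ)
    (hn : ∀ j, ∃ k, n j = p ^ k) (hne : ∀ j, n j • e j = 0) :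
    AugmentationNilpotent p A (∑ j, (n j - 1)) := by
  intro s hs
  set y : κ → AddMonoidAlgebra (ZMod p) A := fun j => 1 - AddMonoidAlgebra.single (e j) 1
  have hpos : ∀ j, 0 < n j := fun j => by
    obtain ⟨k, hk⟩ := hn j
    rw [hk]
    exact pow_pos (Fact.out : p.Prime).pos k
  have : CharP (AddMonoidAlgebra (ZMod p) A) p :=
    charP_of_injective_algebraMap (algebraMap (ZMod p) (AddMonoidAlgebra (ZMod p) A)).injective p
  have hy : ∀ j, y j ^ n j = 0 := fun j => by
    obtain ⟨k, hk⟩ := hn j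
    have := hne j
    rw [hk] at this ⊢
    simp only [y]
    rw [sub_pow_char_pow, AddMonoidAlgebra.single_pow, this]
    simp [← AddMonoidAlgebra.one_def]
  have hbot := ideal_span_pow_eq_bot Finset.univ y n hpos hy
  set I := ⨆ j ∈ Finset.univ, Ideal.span {y j}
  have hI : ∀ a, 1 - AddMonoidAlgebra.single a 1 ∈ I := by
    refine one_sub_single_mem I he ?_
    rintro _ ⟨j, rfl⟩
    have hle : Ideal.span {y j} ≤ I := le_iSup₂_of_le j (Finset.mem_univ j) le_rfl
    exact hle (Ideal.mem_span_singleton_self _)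
  have hmem : ∀ s : Multiset A,
      (s.map fun a => (1 - AddMonoidAlgebra.single a 1 : AddMonoidAlgebra (ZMod p) A)).prod ∈
        I ^ Multiset.card s := by
    intro s
    induction s using Multiset.induction_on with
    | empty => simp
    | cons a s ih =>
      rw [Multiset.map_cons, Multiset.prod_cons, Multiset.card_cons, pow_succ']
      exact Ideal.mul_mem_mul (hI a) ih
  have := Ideal.pow_le_pow_right (Nat.succ_le_of_lt hs) (hmem s)
  rw [Nat.succ_eq_add_one, hbot] at this
  simpa using this

theorem coeff_prod_one_sub_single {K A ι : Type*} [CommRing K] [AddCommGroup A] [DecidableEq A]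
    (f : ι → A) (X : Finset ι) (a : A) :
    (∏ i ∈ X, (1 - AddMonoidAlgebra.single (f i) 1 : AddMonoidAlgebra K A)).coeff a =
      ∑ t ∈ X.powerset with ∑ i ∈ t, f i = a, (-1) ^ #t := by
  classical
  simp only [sub_eq_add_neg, Finset.prod_one_add, ← AddMonoidAlgebra.single_neg,
    AddMonoidAlgebra.prod_single, Finset.prod_const]
  rw [AddMonoidAlgebra.coeff_sum, Finsupp.finsetSum_apply, Finset.sum_filter]
  simp [AddMonoidAlgebra.coeff_single, Finsupp.single_apply]

theorem AugmentationNilpotent.prod_eq_zero {p M : ℕ} {A ι : Type*} [AddCommGroup A]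
    (h : AugmentationNilpotent p A M) (f : ι → A) {X : Finset ι} (hX : M < #X) :
    ∏ i ∈ X, (1 - AddMonoidAlgebra.single (f i) 1 : AddMonoidAlgebra (ZMod p) A) = 0 := by
  have hprod := h (X.val.map f) (by simpa using hX)
  rwa [Multiset.map_map] at hprod

theorem AugmentationNilpotent.exists_le_sum_eq_zero {p : ℕ} [Fact p.Prime] {A : Type*}
    [AddCommGroup A] {M : ℕ} (h : AugmentationNilpotent p A M) {ι : Type*} (f : ι → A)
    (X : Finset ι) (hX : M < #X) : ∃ t ⊆ X, t.Nonempty ∧ ∑ i ∈ t, f i = 0 := by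
  classical
  by_contra! hcon
  have h0 := coeff_prod_one_sub_single (K := ZMod p) f X 0
  have hfil : X.powerset.filter (fun t => ∑ i ∈ t, f i = 0) = {∅} := by
    ext t
    simp only [mem_filter, mem_powerset, mem_singleton]
    refine ⟨fun ht => ?_, fun ht => by simp [ht]⟩
    by_contra hne
    exact hcon t ht.1 (nonempty_iff_ne_empty.2 hne) ht.2
  rw [h.prod_eq_zero f hX, hfil] at h0
  simp at h0

section Counting

variable {G ι : Type*} [AddCommGroup G] [DecidableEq G]

/-- The zero-sum subsequences of length `k` of the sequence `g` restricted to `X`. -/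
def zeroSumSubsets (g : ι → G) (k : ℕ) (X : Finset ι) : Finset (Finset ι) :=
  {t ∈ X.powersetCard k | ∑ i ∈ t, g i = 0}

theorem mem_zeroSumSubsets {g : ι → G} {k : ℕ} {X t : Finset ι} :
    t ∈ zeroSumSubsets g k X ↔ t ⊆ X ∧ #t = k ∧ ∑ i ∈ t, g i = 0 := by
  simp [zeroSumSubsets, and_assoc]

theorem zeroSumSubsets_eq_empty_of_card_lt (g : ι → G) {k : ℕ} {X : Finset ι} (h : #X < k) :
    zeroSumSubsets g k X = ∅ := by
  simp [zeroSumSubsets, powersetCard_eq_empty.2 h]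

theorem zeroSumSubsets_zero (g : ι → G) (X : Finset ι) : zeroSumSubsets g 0 X = {∅} := by
  ext t
  simp only [mem_zeroSumSubsets, card_eq_zero, mem_singleton]
  exact ⟨fun h => h.2.1, fun h => by simp [h]⟩

theorem zeroSumSubsets_eq_empty_of_subset {g : ι → G} {k : ℕ} {X Y : Finset ι} (hY : Y ⊆ X)
    (h : zeroSumSubsets g k X = ∅) : zeroSumSubsets g k Y = ∅ := by
  rw [eq_empty_iff_forall_notMem] at h ⊢
  intro t ht
  rw [mem_zeroSumSubsets] at ht
  exact h t (mem_zeroSumSubsets.2 ⟨ht.1.trans hY, ht.2⟩)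

/-- The signed number, modulo `p`, of zero-sum subsequences with length congruent to `r`
modulo `q`. -/
def signedCount (p q : ℕ) (g : ι → G) (X : Finset ι) (r : ZMod q) : ZMod p :=
  ∑ t ∈ X.powerset with ∑ i ∈ t, (g i, (1 : ZMod q)) = (0, r), (-1) ^ #t

theorem signedCount_eq_zero {p q M : ℕ} (h : AugmentationNilpotent p (G × ZMod q) M)
    (g : ι → G) {X : Finset ι} (hX : M < #X) (r : ZMod q) : signedCount p q g X r = 0 := by
  have h0 := coeff_prod_one_sub_single (K := ZMod p) (fun i => (g i, (1 : ZMod q))) X (0, r)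
  rw [signedCount, ← h0, h.prod_eq_zero _ hX]
  rfl

theorem signedCount_eq_signedCount_sub_one {p q M : ℕ}
    (h : AugmentationNilpotent p (G × ZMod q) M) (g : ι → G) {X : Finset ι} (hX : M ≤ #X)
    (r : ZMod q) : signedCount p q g X r = signedCount p q g X (r - 1) := by
  have hprod := h ((0, 1) ::ₘ X.val.map fun i => (g i, 1)) (by simpa using Nat.lt_succ_of_le hX)
  rw [Multiset.map_cons, Multiset.prod_cons, Multiset.map_map] at hprod
  have h0 := coeff_prod_one_sub_single (K := ZMod p) (fun i => (g i, (1 : ZMod q))) X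
  rw [signedCount, signedCount, ← h0, ← h0]
  set P : AddMonoidAlgebra (ZMod p) (G × ZMod q) :=
    ∏ i ∈ X, (1 - AddMonoidAlgebra.single (g i, (1 : ZMod q)) 1)
  replace hprod : (1 - AddMonoidAlgebra.single ((0 : G), (1 : ZMod q)) 1) * P = 0 := hprod
  rw [sub_mul, one_mul, sub_eq_zero] at hprod
  conv_lhs => rw [hprod]
  rw [AddMonoidAlgebra.coeff_single_mul_apply]
  simp [sub_eq_neg_add]

theorem signedCount_eq_sum {p q : ℕ} (hq : Odd q) (g : ι → G) {X : Finset ι} (hX : #X < 4 * q)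
    {r : ℕ} (hr : r < q) :
    signedCount p q g X r =
      ∑ j ∈ range 4, (-1) ^ (j + r) * (#(zeroSumSubsets g (q * j + r) X) : ZMod p) := by
  classical
  have hfil : ∀ t ∈ X.powerset, ∑ i ∈ t, (g i, (1 : ZMod q)) = (0, (r : ZMod q)) ↔
      t ∈ (range 4).biUnion fun j => zeroSumSubsets g (q * j + r) X := by
    intro t ht
    rw [mem_powerset] at ht
    have hcard := card_le_card ht
    simp only [mem_biUnion, mem_range, mem_zeroSumSubsets, Prod.ext_iff, Prod.fst_sum,
      Prod.snd_sum, sum_const, nsmul_eq_mul, mul_one, ZMod.natCast_eq_natCast_iff']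
    rw [Nat.mod_eq_of_lt hr]
    constructor
    · rintro ⟨h1, h2⟩
      refine ⟨#t / q, Nat.div_lt_of_lt_mul (by rw [mul_comm]; omega), ht, ?_, h1⟩
      rw [← h2, Nat.div_add_mod]
    · rintro ⟨j, -, -, h2, h1⟩
      exact ⟨h1, by rw [h2, Nat.mul_add_mod, Nat.mod_eq_of_lt hr]⟩
  have hset : X.powerset.filter (fun t => ∑ i ∈ t, (g i, (1 : ZMod q)) = (0, (r : ZMod q))) =
      (range 4).biUnion fun j => zeroSumSubsets g (q * j + r) X := by
    ext t
    rw [mem_filter]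
    constructor
    · rintro ⟨h1, h2⟩
      exact (hfil t h1).1 h2
    · intro h
      have : t ∈ X.powerset := by
        simp only [mem_biUnion, mem_zeroSumSubsets] at h
        obtain ⟨_, _, h, _⟩ := h
        exact mem_powerset.2 h
      exact ⟨this, (hfil t this).2 h⟩
  rw [signedCount, hset, sum_biUnion]
  · refine sum_congr rfl fun j _ => ?_
    rw [sum_congr rfl (g := fun _ => ((-1) ^ (j + r) : ZMod p)), sum_const, nsmul_eq_mul, mul_comm]
    intro t ht
    rw [(mem_zeroSumSubsets.1 ht).2.1, pow_add, pow_mul, hq.neg_one_pow, pow_add]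
  · intro j _ j' _ hjj
    rw [Function.onFun, disjoint_left]
    intro t h1 h2
    rw [mem_zeroSumSubsets] at h1 h2
    have : q * j = q * j' := by omega
    exact hjj (Nat.eq_of_mul_eq_mul_left (by omega) this)

theorem card_powersetCard_filter_superset [DecidableEq ι] {t X : Finset ι} (ht : t ⊆ X) {M : ℕ}
    (hM : #t ≤ M) :
    #{I ∈ X.powersetCard M | t ⊆ I} = (#X - #t).choose (M - #t) := by
  rw [← card_sdiff_of_subset ht, ← card_powersetCard]
  refine card_nbij' (· \ t) (· ∪ t) ?_ ?_ ?_ ?_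
  · intro I hI
    simp only [coe_filter, Set.mem_ofPred_eq, mem_powersetCard] at hI
    simp only [mem_coe, mem_powersetCard]
    exact ⟨sdiff_subset_sdiff hI.1.1 le_rfl, by rw [card_sdiff_of_subset hI.2, hI.1.2]⟩
  · intro I hI
    simp only [mem_coe, mem_powersetCard] at hI
    simp only [coe_filter, Set.mem_ofPred_eq, mem_powersetCard]
    refine ⟨⟨union_subset (hI.1.trans sdiff_subset) ht, ?_⟩, subset_union_right⟩
    rw [card_union_of_disjoint (disjoint_sdiff.symm.mono_left hI.1), hI.2]
    omega
  · intro I hI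
    simp only [coe_filter, Set.mem_ofPred_eq] at hI
    exact sdiff_union_of_subset hI.2
  · intro I hI
    simp only [mem_coe, mem_powersetCard] at hI
    exact union_sdiff_cancel_right (disjoint_sdiff.symm.mono_left hI.1)

theorem sum_card_zeroSumSubsets (g : ι → G) (X : Finset ι) {k M : ℕ} (hk : k ≤ M)
    (hM : M ≤ #X) :
    ∑ I ∈ X.powersetCard M, #(zeroSumSubsets g k I) =
      (#X - k).choose (#X - M) * #(zeroSumSubsets g k X) := by
  classical
  have h1 : ∀ I ∈ X.powersetCard M, #(zeroSumSubsets g k I) =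
      ∑ t ∈ zeroSumSubsets g k X, if t ⊆ I then 1 else 0 := by
    intro I hI
    rw [mem_powersetCard] at hI
    rw [← card_filter]
    congr 1
    ext t
    simp only [mem_filter, mem_zeroSumSubsets]
    exact ⟨fun h => ⟨⟨h.1.trans hI.1, h.2⟩, h.1⟩, fun h => ⟨h.2, h.1.2⟩⟩
  rw [sum_congr rfl h1, sum_comm, sum_congr rfl (g := fun _ => (#X - k).choose (#X - M)), sum_const,
    smul_eq_mul, mul_comm]
  intro t ht
  rw [mem_zeroSumSubsets] at ht
  rw [← card_filter, card_powersetCard_filter_superset ht.1 (by omega), ht.2.1,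
    ← Nat.choose_symm (by omega)]
  congr 1
  omega

/-- Double counting of the disjoint pairs of zero-sum subsequences of lengths `a` and `c`. -/
theorem sum_card_zeroSumSubsets_sdiff [DecidableEq ι] (g : ι → G) (X : Finset ι) (a c : ℕ) :
    ∑ A ∈ zeroSumSubsets g a X, #(zeroSumSubsets g c (X \ A)) =
      ∑ J ∈ zeroSumSubsets g (a + c) X, #(zeroSumSubsets g c J) := by
  rw [← card_sigma, ← card_sigma]
  refine card_nbij' (fun x => ⟨x.1 ∪ x.2, x.2⟩) (fun x => ⟨x.1 \ x.2, x.2⟩) ?_ ?_ ?_ ?_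
  · rintro ⟨A, C⟩ h
    simp only [mem_coe, mem_sigma, mem_zeroSumSubsets] at h ⊢
    obtain ⟨⟨h1, h2, h3⟩, h4, h5, h6⟩ := h
    have hd : Disjoint A C := disjoint_sdiff.mono_right h4
    exact ⟨⟨union_subset h1 (h4.trans sdiff_subset), by rw [card_union_of_disjoint hd, h2, h5],
      by rw [sum_union hd, h3, h6, add_zero]⟩, subset_union_right, h5, h6⟩
  · rintro ⟨J, C⟩ h
    simp only [mem_coe, mem_sigma, mem_zeroSumSubsets] at h ⊢
    obtain ⟨⟨h1, h2, h3⟩, h4, h5, h6⟩ := h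
    refine ⟨⟨sdiff_subset.trans h1, by rw [card_sdiff_of_subset h4]; omega, ?_⟩, ?_, h5, h6⟩
    · have := sum_sdiff h4 (f := g)
      rwa [h6, h3, add_zero] at this
    · exact subset_sdiff.2 ⟨h4.trans h1, disjoint_sdiff⟩
  · rintro ⟨A, C⟩ h
    simp only [mem_coe, mem_sigma, mem_zeroSumSubsets] at h
    have hd : Disjoint A C := disjoint_sdiff.mono_right h.2.1
    simp [union_sdiff_cancel_right hd]
  · rintro ⟨J, C⟩ h
    simp only [mem_coe, mem_sigma, mem_zeroSumSubsets] at h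
    simp [sdiff_union_of_subset h.2.1]

theorem choose_prime_pow_cast {p : ℕ} [Fact p.Prime] (m n : ℕ) :
    ((n.choose (p ^ m) : ℕ) : ZMod p) = (n / p ^ m : ℕ) := by
  induction m generalizing n with
  | zero => simp
  | succ m ih =>
    have h := (ZMod.natCast_eq_natCast_iff _ _ _).2
      (Choose.choose_modEq_choose_mod_mul_choose_div_nat (n := n) (k := p ^ (m + 1)) (p := p))
    have hp : 0 < p := (Fact.out : p.Prime).pos
    rw [h, pow_succ, Nat.mul_mod_left, Nat.mul_div_cancel _ hp, Nat.choose_zero_right, one_mul, ih,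
      Nat.div_div_eq_div_mul, mul_comm]

theorem sum_alternating_zeroSumSubsets {p q M : ℕ} (hq : Odd q)
    (h : AugmentationNilpotent p (G × ZMod q) M) (g : ι → G) {X : Finset ι} (hM : M < #X)
    (hX : #X < 4 * q) {r : ℕ} (hr : r < q) :
    (#(zeroSumSubsets g r X) : ZMod p) - #(zeroSumSubsets g (q + r) X) +
      #(zeroSumSubsets g (2 * q + r) X) - #(zeroSumSubsets g (3 * q + r) X) = 0 := by
  have h1 := signedCount_eq_sum (p := p) hq g hX hr
  rw [signedCount_eq_zero h g hM] at h1
  simp only [sum_range_succ, range_zero, sum_empty] at h1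
  rcases neg_one_pow_eq_or (ZMod p) r with h2 | h2 <;>
    simp only [pow_add, h2, mul_comm q, zero_mul, one_mul, zero_add] at h1
  · linear_combination -h1
  · linear_combination h1

theorem sum_alternating_zeroSumSubsets_sub {p q M : ℕ} (hq : Odd q)
    (h : AugmentationNilpotent p (G × ZMod q) M) (g : ι → G) {X : Finset ι} (hM : M ≤ #X)
    (hX : #X < 3 * q - 1) :
    1 - (#(zeroSumSubsets g q X) : ZMod p) + #(zeroSumSubsets g (2 * q) X) =
      (#(zeroSumSubsets g (q - 1) X) : ZMod p) - #(zeroSumSubsets g (2 * q - 1) X) := by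
  have hq0 : 0 < q := hq.pos
  have h1 := signedCount_eq_sum (p := p) hq g (X := X) (by omega) hq0
  have h2 := signedCount_eq_sum (p := p) hq g (X := X) (by omega) (Nat.sub_lt hq0 one_pos)
  have h3 := signedCount_eq_signedCount_sub_one h g hM 0
  rw [Nat.cast_zero] at h1
  rw [Nat.cast_sub (Nat.one_le_of_lt hq0), ZMod.natCast_self, Nat.cast_one, ← h3, h1] at h2
  have he : (-1 : ZMod p) ^ (q - 1) = 1 := (Nat.Odd.sub_odd hq odd_one).neg_one_pow
  simp only [sum_range_succ, range_zero, sum_empty, pow_add, he, zeroSumSubsets_zero, mul_comm q,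
    zero_mul, one_mul, zero_add, add_zero] at h2
  rw [zeroSumSubsets_eq_empty_of_card_lt g (k := 3 * q) (by omega),
    zeroSumSubsets_eq_empty_of_card_lt g (k := 3 * q + (q - 1)) (by omega),
    zeroSumSubsets_eq_empty_of_card_lt g (k := 2 * q + (q - 1)) (by omega),
    show q + (q - 1) = 2 * q - 1 by omega] at h2
  simp only [card_singleton, card_empty, Nat.cast_one, Nat.cast_zero] at h2
  linear_combination h2

/-- A Reiher-type theorem: if the group algebra of `G × ZMod q` has a sufficiently nilpotent
augmentation ideal, then sequences of length `c + 2 * q - 1` have zero-sum subsequences of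
length `q`. -/
theorem exists_zeroSumSubset_card_eq {p m c : ℕ} [Fact p.Prime] (hp : Odd p) (hc : Even c)
    (hcq : c + 2 ≤ 2 * p ^ m) (h : AugmentationNilpotent p (G × ZMod (p ^ m)) (c + (p ^ m - 1)))
    (g : ι → G) (X : Finset ι) (hX : #X = c + 2 * p ^ m - 1) :
    (zeroSumSubsets g (p ^ m) X).Nonempty := by
  classical
  set q := p ^ m with hqdef
  have hq : Odd q := hp.pow
  have hq0 := hq.pos
  have h2 : (2 : ZMod p) ≠ 0 := by
    intro h2
    have : p ∣ 2 := by
      rw [← ZMod.natCast_eq_zero_iff]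
      exact_mod_cast h2
    have := Nat.le_of_dvd two_pos this
    obtain ⟨k, rfl⟩ := hp
    have := (Fact.out : (2 * k + 1).Prime).two_le
    omega
  have hp1 := (Fact.out : p.Prime).one_lt
  rw [nonempty_iff_ne_empty]
  intro hemp
  have hsub : ∀ Y ⊆ X, zeroSumSubsets g q Y = ∅ := fun Y hY =>
    zeroSumSubsets_eq_empty_of_subset hY hemp
  rcases lt_trichotomy c q with hcq' | hcq' | hcq'
  · obtain ⟨Y, hYX, hY⟩ := exists_subset_card_eq (s := X) (n := 2 * q - 1) (by omega)
    have := sum_alternating_zeroSumSubsets hq h g (X := Y) (by omega) (by omega) hq0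
    rw [zeroSumSubsets_zero, add_zero, hsub Y hYX,
      zeroSumSubsets_eq_empty_of_card_lt g (k := 2 * q + 0) (by omega),
      zeroSumSubsets_eq_empty_of_card_lt g (k := 3 * q + 0) (by omega)] at this
    simp at this
  · rw [hcq'] at hc
    exact (Nat.not_even_iff_odd.2 hq) hc
  have h2q : ∀ Y ⊆ X, c + (q - 1) < #Y → #(zeroSumSubsets g (3 * q) Y) = 0 →
      (#(zeroSumSubsets g (2 * q) Y) : ZMod p) = -1 := by
    intro Y hYX hY h3
    have hYle := card_le_card hYX
    have := sum_alternating_zeroSumSubsets hq h g hY (by omega) hq0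
    simp only [add_zero] at this
    rw [zeroSumSubsets_zero, hsub Y hYX, h3] at this
    simp only [card_singleton, card_empty, Nat.cast_one, Nat.cast_zero] at this
    linear_combination this
  have h3q : zeroSumSubsets g (3 * q) X = ∅ := by
    rw [eq_empty_iff_forall_notMem]
    intro J hJ
    rw [mem_zeroSumSubsets] at hJ
    obtain ⟨x, hx⟩ : J.Nonempty := card_pos.1 (by omega)
    have hcard := card_erase_of_mem hx
    have hK := h2q (J.erase x) ((erase_subset _ _).trans hJ.1) (by omega)
      (by rw [zeroSumSubsets_eq_empty_of_card_lt g (by omega), card_empty])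
    have hne : zeroSumSubsets g (2 * q) (J.erase x) ≠ ∅ := by
      intro h0
      rw [h0] at hK
      simp at hK
    obtain ⟨T, hT⟩ := nonempty_iff_ne_empty.2 hne
    rw [mem_zeroSumSubsets] at hT
    have hTJ := hT.1.trans (erase_subset _ _)
    have hmem : J \ T ∈ zeroSumSubsets g q X := by
      refine mem_zeroSumSubsets.2 ⟨sdiff_subset.trans hJ.1, ?_, ?_⟩
      · rw [card_sdiff_of_subset hTJ]
        omega
      · have := sum_sdiff hTJ (f := g)
        rwa [hT.2.2, hJ.2.2, add_zero] at this
    rw [hemp] at hmem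
    exact notMem_empty _ hmem
  have e1 := h2q X le_rfl (by omega) (by rw [h3q, card_empty])
  have e2 := sum_alternating_zeroSumSubsets hq h g (X := X) (by omega) (by omega)
    (Nat.sub_lt hq0 one_pos)
  rw [zeroSumSubsets_eq_empty_of_card_lt g (k := 3 * q + (q - 1)) (by omega), card_empty,
    show q + (q - 1) = 2 * q - 1 by omega] at e2
  have e3 : (#(zeroSumSubsets g (q - 1) X) : ZMod p) =
      #(zeroSumSubsets g (2 * q + (q - 1)) X) := by
    have hdc := congrArg (Nat.cast (R := ZMod p)) (sum_card_zeroSumSubsets_sdiff g X (q - 1) (2 * q))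
    push_cast at hdc
    rw [sum_congr rfl (g := fun _ => (-1 : ZMod p)),
      sum_congr rfl (g := fun _ => (-1 : ZMod p)) (s₁ := zeroSumSubsets g (q - 1 + 2 * q) X),
      sum_const, sum_const, add_comm (q - 1)] at hdc
    · simpa using hdc
    · intro J hJ
      rw [mem_zeroSumSubsets] at hJ
      exact h2q J hJ.1 (by omega)
        (by rw [zeroSumSubsets_eq_empty_of_card_lt g (by omega), card_empty])
    · intro A hA
      rw [mem_zeroSumSubsets] at hA
      refine h2q _ sdiff_subset (by rw [card_sdiff_of_subset hA.1]; omega) ?_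
      rw [zeroSumSubsets_eq_empty_of_subset sdiff_subset h3q, card_empty]
  have e4 : (3 : ZMod p) + #(zeroSumSubsets g (2 * q) X) =
      2 * #(zeroSumSubsets g (q - 1) X) - #(zeroSumSubsets g (2 * q - 1) X) := by
    have hI : ∀ I ∈ X.powersetCard (c + (q - 1)),
        (#(zeroSumSubsets g 0 I) : ZMod p) + #(zeroSumSubsets g (2 * q) I) =
          #(zeroSumSubsets g (q - 1) I) - #(zeroSumSubsets g (2 * q - 1) I) := by
      intro I hI
      rw [mem_powersetCard] at hI
      have := sum_alternating_zeroSumSubsets_sub hq h g (X := I) (by omega) (by omega)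
      rw [hsub I hI.1, card_empty, Nat.cast_zero, sub_zero] at this
      rw [← this, zeroSumSubsets_zero, card_singleton, Nat.cast_one]
    have hchoose : ∀ k a, k ≤ c + (q - 1) → (#X - k) / q = a →
        ∑ I ∈ X.powersetCard (c + (q - 1)), (#(zeroSumSubsets g k I) : ZMod p) =
          a * #(zeroSumSubsets g k X) := by
      intro k a hk ha
      have := congrArg (Nat.cast (R := ZMod p))
        (sum_card_zeroSumSubsets g X hk (by omega))
      push_cast at this
      rw [this, show #X - (c + (q - 1)) = q by omega, hqdef, choose_prime_pow_cast, ← hqdef, ha]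
    have hdiv : ∀ a b : ℕ, a * q ≤ b → b < (a + 1) * q → b / q = a := fun a b h1 h2 =>
      Nat.div_eq_of_lt_le h1 h2
    have := sum_congr rfl hI
    rw [sum_add_distrib, sum_sub_distrib, hchoose 0 3 (by omega) (hdiv _ _ (by omega) (by omega)),
      hchoose (2 * q) 1 (by omega) (hdiv _ _ (by omega) (by omega)),
      hchoose (q - 1) 2 (by omega) (hdiv _ _ (by omega) (by omega)),
      hchoose (2 * q - 1) 1 (by omega) (hdiv _ _ (by omega) (by omega)),
      zeroSumSubsets_zero] at this
    simpa using this
  apply h2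
  push_cast at e2
  linear_combination e4 - e1 + e2 + e3

end Counting

theorem exists_indexing {G : Type*} (S : Multiset G) {N : ℕ} (hN : N ≤ Multiset.card S) :
    ∃ (k : ℕ) (f : Fin k → G) (X : Finset (Fin k)), #X = N ∧ ∀ t ⊆ X, t.val.map f ≤ S := by
  induction S using Quotient.inductionOn with
  | h l =>
    obtain ⟨X, -, hX⟩ := exists_subset_card_eq (s := (univ : Finset (Fin l.length))) (n := N)
      (by simpa using hN)
    refine ⟨l.length, l.get, X, hX, fun t _ => ?_⟩
    have hl : (univ : Finset (Fin l.length)).val.map l.get = (l : Multiset G) := by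
      rw [Fin.univ_val_map, List.ofFn_get]
    change _ ≤ (l : Multiset G)
    rw [← hl]
    exact Multiset.map_le_map (val_le_iff.2 (subset_univ t))

theorem exists_replicate_of_le {G J : Type*} (s : Finset J) (m : J → ℕ) (v : J → G)
    (T : Multiset G) (hT : T ≤ ∑ j ∈ s, Multiset.replicate (m j) (v j)) :
    ∃ c : J → ℕ, (∀ j, c j ≤ m j) ∧ T = ∑ j ∈ s, Multiset.replicate (c j) (v j) := by
  classical
  induction s using Finset.induction_on generalizing T with
  | empty => exact ⟨0, by simp, by simpa using hT⟩
  | insert a s ha ih =>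
    rw [sum_insert ha] at hT
    obtain ⟨c, hc, hTc⟩ := ih (T - Multiset.replicate (m a) (v a))
      (tsub_le_iff_left.2 hT)
    obtain ⟨k, hk, hTk⟩ := Multiset.le_replicate_iff.1
      (Multiset.inter_le_right (s := T) (t := Multiset.replicate (m a) (v a)))
    refine ⟨Function.update c a k, fun j => ?_, ?_⟩
    · rcases eq_or_ne j a with rfl | hj
      · simpa using hk
      · simpa [hj] using hc j
    · rw [sum_insert ha, Function.update_self, ← hTk,
        sum_congr rfl (g := fun j => Multiset.replicate (c j) (v j)), ← hTc, add_comm,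
        Multiset.sub_add_inter]
      intro j hj
      rw [Function.update_of_ne]
      rintro rfl
      exact ha hj

section Invariants

variable {G : Type*} [AddCommGroup G]

/-- The sequence `S` has a nonempty zero-sum subsequence with length in `L`. -/
def HasZeroSum (L : Set ℕ) (S : Multiset G) : Prop :=
  ∃ T : Multiset G, T ≤ S ∧ T ≠ 0 ∧ T.sum = 0 ∧ Multiset.card T ∈ L

theorem zsInv_le {L : Set ℕ} {l : ℕ} (hl : 0 < l)
    (h : ∀ S : Multiset G, l ≤ Multiset.card S → HasZeroSum L S) : zsInv G L ≤ l :=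
  Nat.sInf_le ⟨hl, h⟩

theorem zsInv_spec {L : Set ℕ} {l : ℕ} (hl : 0 < l)
    (h : ∀ S : Multiset G, l ≤ Multiset.card S → HasZeroSum L S) :
    0 < zsInv G L ∧ ∀ S : Multiset G, zsInv G L ≤ Multiset.card S → HasZeroSum L S :=
  Nat.sInf_mem (s := {l : ℕ | 0 < l ∧ ∀ S : Multiset G, l ≤ Multiset.card S → HasZeroSum L S})
    ⟨l, hl, h⟩

theorem card_lt_zsInv {L : Set ℕ} {l : ℕ} (hl : 0 < l)
    (h : ∀ S : Multiset G, l ≤ Multiset.card S → HasZeroSum L S) {S : Multiset G}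
    (hS : ¬ HasZeroSum L S) : Multiset.card S < zsInv G L :=
  not_le.1 fun hle => hS ((zsInv_spec hl h).2 S hle)

theorem exists_not_hasZeroSum (G : Type*) [AddCommGroup G] (L : Set ℕ) :
    ∃ S : Multiset G, zsInv G L ≤ Multiset.card S + 1 ∧ ¬ HasZeroSum L S := by
  rcases le_or_gt (zsInv G L) 1 with h | h
  · refine ⟨0, by simpa using h, ?_⟩
    rintro ⟨T, hT, hT0, -⟩
    exact hT0 (Multiset.le_zero.1 hT)
  · by_contra! hcon
    have := zsInv_le (G := G) (L := L) (l := zsInv G L - 1) (by omega)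
      fun S hS => hcon S (by omega)
    omega

theorem etaInv_add_exponent_le_egzConst {l : ℕ} (hl : 0 < l) (hn : 0 < AddMonoid.exponent G)
    (h : ∀ S : Multiset G, l ≤ Multiset.card S → HasZeroSum {AddMonoid.exponent G} S) :
    etaInv G + AddMonoid.exponent G - 1 ≤ egzConst G := by
  classical
  obtain ⟨S, hcard, hS⟩ := exists_not_hasZeroSum G {t | 0 < t ∧ t ≤ AddMonoid.exponent G}
  have hlt : Multiset.card (S + Multiset.replicate (AddMonoid.exponent G - 1) 0) < egzConst G := by
    refine card_lt_zsInv hl h ?_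
    rintro ⟨T, hT, -, hT0, hTc⟩
    rw [Set.mem_singleton_iff] at hTc
    obtain ⟨k, hk, hTk⟩ := Multiset.le_replicate_iff.1
      (Multiset.inter_le_right (s := T)
        (t := Multiset.replicate (AddMonoid.exponent G - 1) (0 : G)))
    have hadd := Multiset.sub_add_inter T (Multiset.replicate (AddMonoid.exponent G - 1) (0 : G))
    rw [hTk] at hadd
    have hsum := congrArg Multiset.sum hadd
    have hc := congrArg Multiset.card hadd
    rw [Multiset.sum_add, Multiset.sum_replicate, smul_zero, add_zero, hT0] at hsum
    rw [Multiset.card_add, Multiset.card_replicate, hTc] at hc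
    refine hS ⟨T - Multiset.replicate (AddMonoid.exponent G - 1) 0,
      tsub_le_iff_right.2 hT, ?_, hsum, ?_, ?_⟩
    · rw [← Multiset.card_pos]
      omega
    · omega
    · omega
  rw [Multiset.card_add, Multiset.card_replicate] at hlt
  have : etaInv G ≤ Multiset.card S + 1 := hcard
  omega

end Invariants

section Decomposition

variable {G κ : Type*} [AddCommGroup G] [DecidableEq κ] {n : κ → ℕ}

/-- The basis of `G` that corresponds to a decomposition of `G` into cyclic groups. -/
def basisOf (φ : G ≃+ ∀ j, ZMod (n j)) (j : κ) : G := φ.symm (Pi.single j 1)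

theorem smul_basisOf (φ : G ≃+ ∀ j, ZMod (n j)) (j : κ) : n j • basisOf φ j = 0 := by
  rw [basisOf, ← map_nsmul, ← Pi.single_smul]
  simp

theorem apply_basisOf (φ : G ≃+ ∀ j, ZMod (n j)) (i j : κ) :
    φ (basisOf φ j) i = if i = j then 1 else 0 := by
  rw [basisOf, AddEquiv.apply_symm_apply]
  rcases eq_or_ne i j with rfl | h
  · simp
  · simp [h]

variable [Fintype κ]

theorem apply_sum_basisOf (φ : G ≃+ ∀ j, ZMod (n j)) (c : κ → ℕ) (i : κ) :
    φ (∑ j, c j • basisOf φ j) i = c i := by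
  rw [map_sum, Finset.sum_apply, Finset.sum_eq_single i]
  · simp [apply_basisOf]
  · intro j _ hj
    simp [apply_basisOf, hj.symm]
  · simp

theorem closure_basisOf (hn : ∀ j, 0 < n j) (φ : G ≃+ ∀ j, ZMod (n j)) :
    AddSubgroup.closure (Set.range (basisOf φ)) = ⊤ := by
  rw [eq_top_iff]
  intro a _
  have ha : a = ∑ j, (φ a j).val • basisOf φ j := by
    apply φ.injective
    funext i
    have : NeZero (n i) := ⟨(hn i).ne'⟩
    rw [apply_sum_basisOf, ZMod.natCast_zmod_val]
  rw [ha]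
  exact AddSubgroup.sum_mem _ fun j _ =>
    nsmul_mem (AddSubgroup.subset_closure (Set.mem_range_self j)) _

theorem augmentationNilpotent_prod_zmod {p m : ℕ} [Fact p.Prime] (φ : G ≃+ ∀ j, ZMod (n j))
    (hn : ∀ j, ∃ k, n j = p ^ k) :
    AugmentationNilpotent p (G × ZMod (p ^ m)) (∑ j, (n j - 1) + (p ^ m - 1)) := by
  have hp := (Fact.out : p.Prime).pos
  have hn0 : ∀ j, 0 < n j := fun j => by
    obtain ⟨k, hk⟩ := hn j
    exact hk ▸ pow_pos hp k
  have h := augmentationNilpotent_of_closure (p := p) (κ := Option κ)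
    (fun o => o.elim ((0, 1) : G × ZMod (p ^ m)) fun j => (basisOf φ j, 0)) ?_
    (fun o => o.elim (p ^ m) n) ?_ ?_
  · rw [Fintype.sum_option, add_comm] at h
    exact h
  · rw [eq_top_iff]
    rintro ⟨a, z⟩ -
    have : NeZero (p ^ m) := ⟨(pow_pos hp m).ne'⟩
    set K := AddSubgroup.closure (Set.range fun o : Option κ =>
      o.elim ((0, 1) : G × ZMod (p ^ m)) fun j => (basisOf φ j, 0))
    have h1 : ((0, z) : G × ZMod (p ^ m)) ∈ K := by
      have : ((0, z) : G × ZMod (p ^ m)) = z.val • ((0, 1) : G × ZMod (p ^ m)) := by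
        simp
      rw [this]
      exact nsmul_mem (AddSubgroup.subset_closure (Set.mem_range_self none)) _
    have h2 : AddSubgroup.closure (Set.range (basisOf φ)) ≤
        K.comap (AddMonoidHom.inl G (ZMod (p ^ m))) := by
      rw [AddSubgroup.closure_le]
      rintro _ ⟨j, rfl⟩
      exact AddSubgroup.subset_closure ⟨some j, rfl⟩
    have h3 : ((a, 0) : G × ZMod (p ^ m)) ∈ K :=
      h2 (by rw [closure_basisOf hn0]; trivial)
    simpa using K.add_mem h3 h1
  · rintro (_ | j)
    · exact ⟨m, rfl⟩
    · exact hn j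
  · rintro (_ | j)
    · simp [Prod.ext_iff]
    · simp [Prod.ext_iff, smul_basisOf]

theorem hasZeroSum_of_sum_lt_card {p : ℕ} [Fact p.Prime] (φ : G ≃+ ∀ j, ZMod (n j))
    (hn : ∀ j, ∃ k, n j = p ^ k) (S : Multiset G) (hS : ∑ j, (n j - 1) + 1 ≤ Multiset.card S) :
    HasZeroSum {t | 0 < t} S := by
  have hn0 : ∀ j, 0 < n j := fun j => by
    obtain ⟨k, hk⟩ := hn j
    exact hk ▸ pow_pos (Fact.out : p.Prime).pos k
  have hnil := augmentationNilpotent_of_closure (p := p) (basisOf φ) (closure_basisOf hn0 φ) n hn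
    (smul_basisOf φ)
  obtain ⟨k, f, X, hX, hXS⟩ := exists_indexing S le_rfl
  obtain ⟨t, ht, hne, hsum⟩ := hnil.exists_le_sum_eq_zero f X (by omega)
  have hpos : 0 < Multiset.card (t.val.map f) := by simpa [card_pos] using hne
  exact ⟨t.val.map f, hXS t ht, Multiset.card_pos.1 hpos, hsum, hpos⟩

theorem davenport_eq {p : ℕ} [Fact p.Prime] (φ : G ≃+ ∀ j, ZMod (n j))
    (hn : ∀ j, ∃ k, n j = p ^ k) : davenport G = ∑ j, (n j - 1) + 1 := by
  refine le_antisymm (zsInv_le (Nat.succ_pos _) (hasZeroSum_of_sum_lt_card φ hn)) ?_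
  have := card_lt_zsInv (Nat.succ_pos _) (hasZeroSum_of_sum_lt_card φ hn)
    (S := ∑ j, Multiset.replicate (n j - 1) (basisOf φ j)) ?_
  · simpa [davenport, Multiset.card_sum] using this
  rintro ⟨T, hT, hT0, hsum, -⟩
  obtain ⟨c, hc, rfl⟩ := exists_replicate_of_le _ _ _ _ hT
  rw [Multiset.sum_sum] at hsum
  simp only [Multiset.sum_replicate] at hsum
  refine hT0 (Finset.sum_eq_zero fun i _ => ?_)
  have hi := apply_sum_basisOf φ c i
  rw [hsum, map_zero, Pi.zero_apply, eq_comm, ZMod.natCast_eq_zero_iff] at hi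
  have hn0 : 0 < n i := by
    obtain ⟨k, hk⟩ := hn i
    exact hk ▸ pow_pos (Fact.out : p.Prime).pos k
  rw [Nat.eq_zero_of_dvd_of_lt hi (by have := hc i; omega), Multiset.replicate_zero]

/-- The standard lower bound for `η`, by doubling a zero-sum free sequence of the complement of
a cyclic summand of maximal order. -/
theorem two_mul_sum_lt_etaInv (φ : G ≃+ ∀ j, ZMod (n j)) (hn : ∀ j, 0 < n j) {i₀ : κ}
    (hi₀ : n i₀ = AddMonoid.exponent G) {l : ℕ} (hl : 0 < l)
    (h : ∀ S : Multiset G, l ≤ Multiset.card S →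
      HasZeroSum {t | 0 < t ∧ t ≤ AddMonoid.exponent G} S) :
    2 * ∑ j, (n j - 1) + 1 < etaInv G + n i₀ := by
  classical
  set b := basisOf φ
  set S : Multiset G := ∑ j, Multiset.replicate (n j - 1) (b j) +
    ∑ j ∈ univ.erase i₀, Multiset.replicate (n j - 1) (b j + b i₀)
  have hlt : Multiset.card S < etaInv G := by
    refine card_lt_zsInv hl h ?_
    rintro ⟨T, hT, -, hsum, hTpos, hTcard⟩
    obtain ⟨c, hc, hTc⟩ := exists_replicate_of_le _ _ _ _ (tsub_le_iff_right.2 hT)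
    obtain ⟨c', hc', hTc'⟩ := exists_replicate_of_le _ _ _ _ (Multiset.inter_le_right (s := T)
      (t := ∑ j ∈ univ.erase i₀, Multiset.replicate (n j - 1) (b j + b i₀)))
    have hadd := Multiset.sub_add_inter T
      (∑ j ∈ univ.erase i₀, Multiset.replicate (n j - 1) (b j + b i₀))
    rw [hTc, hTc'] at hadd
    rw [← hadd] at hsum hTpos hTcard
    simp only [Multiset.sum_add, Multiset.sum_sum, Multiset.sum_replicate] at hsum
    simp only [Multiset.card_add, Multiset.card_sum, Multiset.card_replicate] at hTpos hTcard
    rw [← Finset.sum_erase_add univ c (mem_univ i₀)] at hTpos hTcard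
    rw [← hi₀] at hTcard
    set D := ∑ j ∈ univ.erase i₀, c' j with hD
    set d : κ → ℕ := Function.update c' i₀ D with hd
    have hd₀ : d i₀ = D := by simp [d]
    have hdj : ∀ j, j ≠ i₀ → d j = c' j := fun j hj => by simp [d, hj]
    have hdsum : ∑ j ∈ univ.erase i₀, c' j • (b j + b i₀) = ∑ j, d j • b j := by
      rw [← Finset.sum_erase_add univ (fun j => d j • b j) (mem_univ i₀), hd₀, hD, Finset.sum_smul,
        ← Finset.sum_add_distrib]
      refine Finset.sum_congr rfl fun j hj => ?_
      rw [hdj j (ne_of_mem_erase hj), smul_add]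
    rw [hdsum, ← Finset.sum_add_distrib] at hsum
    simp only [← add_smul] at hsum
    have hdvd : ∀ i, n i ∣ c i + d i := fun i => by
      have hi := apply_sum_basisOf φ (fun j => c j + d j) i
      rwa [hsum, map_zero, Pi.zero_apply, eq_comm, ZMod.natCast_eq_zero_iff] at hi
    have hdvd₀ := hdvd i₀
    rw [hd₀] at hdvd₀
    have hn₀ := hn i₀
    have hc₀ := hc i₀
    rcases Nat.eq_zero_or_pos (c i₀ + D) with h0 | h0
    · have hc'0 : ∀ j ∈ univ.erase i₀, c' j = 0 := Finset.sum_eq_zero_iff.1 (by omega)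
      have hc0 : ∑ j ∈ univ.erase i₀, c j = 0 := Finset.sum_eq_zero fun j hj => by
        have hj' := hdvd j
        rw [hdj j (ne_of_mem_erase hj), hc'0 j hj, add_zero] at hj'
        have := hn j
        exact Nat.eq_zero_of_dvd_of_lt hj' (by have := hc j; omega)
      omega
    · have hle := Nat.le_of_dvd h0 hdvd₀
      have hc0 : ∀ j ∈ univ.erase i₀, c j = 0 := Finset.sum_eq_zero_iff.1 (by omega)
      have hD0 : D = 0 := Finset.sum_eq_zero fun j hj => by
        have hj' := hdvd j
        rw [hdj j (ne_of_mem_erase hj), hc0 j hj, zero_add] at hj'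
        have := hn j
        exact Nat.eq_zero_of_dvd_of_lt hj' (by have := hc' j; omega)
      omega
  have hcard : Multiset.card S + (n i₀ - 1) = 2 * ∑ j, (n j - 1) := by
    have := Finset.sum_erase_add univ (fun j => n j - 1) (mem_univ i₀)
    simp only [S, Multiset.card_add, Multiset.card_sum, Multiset.card_replicate]
    omega
  have := hn i₀
  omega

end Decomposition

/-- A finite abelian `p`-group is a product of cyclic groups of `p`-power orders. -/
theorem exists_equiv_pi_zmod {p : ℕ} (hp : p.Prime) (G : Type*) [AddCommGroup G] [Finite G]
    (hpG : ∀ g : G, ∃ k : ℕ, p ^ k • g = 0) :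
    ∃ (κ : Type) (_ : Fintype κ) (n : κ → ℕ) (_ : G ≃+ ∀ j, ZMod (n j)),
      ∀ j, ∃ k, n j = p ^ k := by
  classical
  obtain ⟨κ, hκ, r, -, e, ⟨φ⟩⟩ := AddCommGroup.equiv_directSum_zmod_of_finite G
  let ψ := φ.trans (DirectSum.addEquivProd fun j => ZMod (r j ^ e j))
  refine ⟨κ, hκ, fun j => r j ^ e j, ψ, fun j => ?_⟩
  obtain ⟨k, hk⟩ := hpG (basisOf ψ j)
  have h := congrFun (congrArg ψ hk) j
  rw [map_nsmul, Pi.smul_apply, apply_basisOf, if_pos rfl, map_zero, Pi.zero_apply, nsmul_eq_mul,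
    mul_one, ZMod.natCast_eq_zero_iff] at h
  obtain ⟨i, -, hi⟩ := (Nat.dvd_prime_pow hp).1 h
  exact ⟨i, hi⟩

theorem exponent_eq {G κ : Type*} [AddCommGroup G] [Fintype κ] {n : κ → ℕ} {p : ℕ}
    (φ : G ≃+ ∀ j, ZMod (n j)) (hn : ∀ j, ∃ k, n j = p ^ k) :
    (IsEmpty κ ∧ AddMonoid.exponent G = 1) ∨ ∃ i₀, n i₀ = AddMonoid.exponent G := by
  rw [AddMonoid.exponent_eq_of_addEquiv φ, AddMonoid.exponent_pi]
  simp only [ZMod.exponent]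
  rcases isEmpty_or_nonempty κ with hκ | hκ
  · exact Or.inl ⟨hκ, by simp⟩
  · right
    choose k hk using hn
    obtain ⟨i₀, hi₀⟩ := Finite.exists_max k
    refine ⟨i₀, Nat.dvd_antisymm (Finset.dvd_lcm (mem_univ i₀)) (Finset.lcm_dvd fun j _ => ?_)⟩
    rw [hk, hk]
    exact pow_dvd_pow p (hi₀ j)

theorem hasZeroSum_exponent {p m : ℕ} [Fact p.Prime] (hodd : Odd p) {G κ : Type*}
    [AddCommGroup G] [Fintype κ] {n : κ → ℕ} (φ : G ≃+ ∀ j, ZMod (n j))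
    (hn : ∀ j, ∃ k, n j = p ^ k) (hle : ∑ j, (n j - 1) + 2 ≤ 2 * p ^ m) (S : Multiset G)
    (hS : ∑ j, (n j - 1) + 2 * p ^ m - 1 ≤ Multiset.card S) : HasZeroSum {p ^ m} S := by
  classical
  have heven : Even (∑ j, (n j - 1)) := Finset.even_sum _ fun j _ => by
    obtain ⟨k, hk⟩ := hn j
    rw [hk]
    exact Nat.Odd.sub_odd hodd.pow odd_one
  obtain ⟨N, f, X, hX, hXS⟩ := exists_indexing S hS
  obtain ⟨t, ht⟩ := exists_zeroSumSubset_card_eq hodd heven hle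
    (augmentationNilpotent_prod_zmod φ hn) f X hX
  rw [mem_zeroSumSubsets] at ht
  have hcard : Multiset.card (t.val.map f) = p ^ m := by simpa using ht.2.1
  refine ⟨t.val.map f, hXS t ht.1, Multiset.card_pos.1 ?_, ht.2.2, hcard⟩
  rw [hcard]
  exact pow_pos (Fact.out : p.Prime).pos m

end ZeroSum

/-- For an odd prime `p` and a finite abelian `p`-group `G` with
`D(G) ≤ 2·exp(G) − 1`, we have
`2·D(G) − 1 ≤ η(G) + exp(G) − 1 ≤ s(G) ≤ D(G) + 2·exp(G) − 2`. -/
theorem stmt11 (p : ℕ) (hp : p.Prime) (hodd : Odd p)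
    (G : Type*) [AddCommGroup G] [Finite G]
    (hpG : ∀ g : G, ∃ k : ℕ, p ^ k • g = 0)
    (hD : davenport G ≤ 2 * AddMonoid.exponent G - 1) :
    2 * davenport G - 1 ≤ etaInv G + AddMonoid.exponent G - 1 ∧
      etaInv G + AddMonoid.exponent G - 1 ≤ egzConst G ∧
      egzConst G ≤ davenport G + 2 * AddMonoid.exponent G - 2 := by
  classical
  have : Fact p.Prime := ⟨hp⟩
  obtain ⟨κ, _, n, φ, hn⟩ := ZeroSum.exists_equiv_pi_zmod hp G hpG
  have hn0 : ∀ j, 0 < n j := fun j => by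
    obtain ⟨k, hk⟩ := hn j
    exact hk ▸ pow_pos hp.pos k
  have hexp := ZeroSum.exponent_eq φ hn
  obtain ⟨m, hm⟩ : ∃ m, AddMonoid.exponent G = p ^ m := by
    rcases hexp with ⟨-, h⟩ | ⟨i₀, h⟩
    · exact ⟨0, by simpa using h⟩
    · rw [← h]
      exact hn i₀
  have hpos : 0 < AddMonoid.exponent G := hm ▸ pow_pos hp.pos m
  have hdav := ZeroSum.davenport_eq φ hn
  have hl : 0 < ∑ j, (n j - 1) + 2 * AddMonoid.exponent G - 1 := by omega
  have hS : ∀ S : Multiset G, ∑ j, (n j - 1) + 2 * AddMonoid.exponent G - 1 ≤ Multiset.card S →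
      ZeroSum.HasZeroSum {AddMonoid.exponent G} S := by
    rw [hm]
    exact ZeroSum.hasZeroSum_exponent hodd φ hn (by omega)
  have hS' : ∀ S : Multiset G, ∑ j, (n j - 1) + 2 * AddMonoid.exponent G - 1 ≤ Multiset.card S →
      ZeroSum.HasZeroSum {t | 0 < t ∧ t ≤ AddMonoid.exponent G} S := fun S h => by
    obtain ⟨T, hT, hT0, hsum, hcard⟩ := hS S h
    exact ⟨T, hT, hT0, hsum, Multiset.card_pos.2 hT0, le_of_eq hcard⟩
  refine ⟨?_, ZeroSum.etaInv_add_exponent_le_egzConst hl hpos hS, ?_⟩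
  · rcases hexp with ⟨hκ, h⟩ | ⟨i₀, h⟩
    · have heta : 0 < etaInv G := (ZeroSum.zsInv_spec hl hS').1
      rw [Finset.univ_eq_empty, Finset.sum_empty] at hdav
      omega
    · have := ZeroSum.two_mul_sum_lt_etaInv φ hn0 h hl hS'
      omega
  · have : egzConst G ≤ _ := ZeroSum.zsInv_le hl hS
    omega
end

section
/- Let p be a prime and let G be a finite abelian p-group, written as G ≅ C_{n₁} ⊕ ⋯ ⊕ C_{n_r} with 1 < n₁ ∣ n₂ ∣ ⋯ ∣ n_r. Then D(G) = 1 + Σ_{i=1}^{r} (n_i − 1). -/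
section

open AddMonoidAlgebra

/-- A finite sum of elements `x` of a semiring with `x i ^ n i = 0` has vanishing
`(1 + ∑ (n i - 1))`-th power. -/
theorem Finset.sum_pow_eq_zero_of_pow_eq_zero {R ι : Type*} [CommSemiring R] (s : Finset ι)
    (x : ι → R) (n : ι → ℕ) (hx : ∀ i ∈ s, x i ^ n i = 0) :
    (∑ i ∈ s, x i) ^ (1 + ∑ i ∈ s, (n i - 1)) = 0 := by
  classical
  induction s using Finset.induction_on with
  | empty => simp
  | insert a s ha ih =>
    rw [Finset.sum_insert ha, Finset.sum_insert ha]
    exact (Commute.all _ _).add_pow_eq_zero_of_add_le_succ_of_pow_eq_zero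
      (hx a (Finset.mem_insert_self a s))
      (ih fun i hi => hx i (Finset.mem_insert_of_mem hi)) (by omega)

theorem Multiset.prod_mem_pow_card {R : Type*} [CommSemiring R] (I : Ideal R) (S : Multiset R)
    (hS : ∀ x ∈ S, x ∈ I) : S.prod ∈ I ^ S.card := by
  induction S using Multiset.induction_on with
  | empty => simp
  | cons a S ih =>
    rw [Multiset.prod_cons, Multiset.card_cons, pow_succ']
    exact Ideal.mul_mem_mul (hS a (Multiset.mem_cons_self a S))
      (ih fun x hx => hS x (Multiset.mem_cons_of_mem hx))

/-- The elements `g` with `1 - X ^ g ∈ I` form a submonoid. -/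
def augmentationSubmonoid {R G : Type*} [CommRing R] [AddCommMonoid G]
    (I : Ideal (AddMonoidAlgebra R G)) : AddSubmonoid G where
  carrier := {g | 1 - single g (1 : R) ∈ I}
  zero_mem' := by simp [← one_def]
  add_mem' {a b} ha hb := by
    have h : (1 : AddMonoidAlgebra R G) - single (a + b) 1 =
        (1 - single a 1) + single a 1 * (1 - single b 1) := by
      rw [mul_sub, single_mul_single]; simp
    simp only [Set.mem_ofPred_eq] at ha hb ⊢
    rw [h]
    exact I.add_mem ha (I.mul_mem_left _ hb)

/-- Away from `1`, the product `∏ (1 - X ^ g)` over a multiset is supported on the sums of its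
nonempty submultisets. -/
theorem exists_sum_eq_of_coeff_prod_sub_one_ne_zero {R G : Type*} [CommRing R] [AddCommGroup G]
    (S : Multiset G) (g : G)
    (hg : ((S.map fun h => 1 - single h (1 : R)).prod - 1).coeff g ≠ 0) :
    ∃ T ≤ S, T ≠ 0 ∧ T.sum = g := by
  induction S using Multiset.induction_on generalizing g with
  | empty => simp at hg
  | cons a S ih =>
    rw [Multiset.map_cons, Multiset.prod_cons] at hg
    set P := (S.map fun h => 1 - single h (1 : R)).prod
    have h : (1 - single a (1 : R)) * P - 1 = (P - 1) - single a 1 * (P - 1) - single a 1 := by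
      ring
    by_cases h₁ : (P - 1).coeff g = 0
    · by_cases h₂ : (P - 1).coeff (-a + g) = 0
      · have h₃ : a = g := by
          by_contra hne
          apply hg
          rw [h]
          generalize P - 1 = Q at h₁ h₂ ⊢
          simp [coeff_single_mul_apply, h₁, h₂, hne]
        exact ⟨{a}, by simp, by simp, by simpa using h₃⟩
      · obtain ⟨T, hT, -, hs⟩ := ih _ h₂
        exact ⟨a ::ₘ T, Multiset.cons_le_cons a hT, by simp, by simp [hs]⟩
    · obtain ⟨T, hT, h0, hs⟩ := ih _ h₁
      exact ⟨T, hT.trans (Multiset.le_cons_self S a), h0, hs⟩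

theorem Multiset.exists_le_map_eq_of_le_map {α β : Type*} (f : α → β) {M : Multiset α}
    {T : Multiset β} (h : T ≤ M.map f) : ∃ M' ≤ M, M'.map f = T := by
  classical
  induction M using Multiset.induction_on generalizing T with
  | empty => exact ⟨0, le_rfl, by simpa [eq_comm] using h⟩
  | cons a M ih =>
    rw [Multiset.map_cons] at h
    by_cases ha : f a ∈ T
    · obtain ⟨M', hM, hT⟩ := ih (Multiset.erase_le_iff_le_cons.2 h)
      exact ⟨a ::ₘ M', Multiset.cons_le_cons a hM, by
        rw [Multiset.map_cons, hT, Multiset.cons_erase ha]⟩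
    · obtain ⟨M', hM, hT⟩ := ih ((Multiset.le_cons_of_notMem ha).1 h)
      exact ⟨M', hM.trans (Multiset.le_cons_self M a), hT⟩

/-- A long sequence over a finite abelian `p`-group generated by elements `e i` of orders
dividing the prime powers `n i` has a nonempty zero-sum subsequence. -/
theorem exists_zero_sum_of_closure_eq_top {G ι : Type*} [AddCommGroup G] [Fintype ι] {p : ℕ}
    [Fact p.Prime] (e : ι → G) (he : AddSubmonoid.closure (Set.range e) = ⊤) (n : ι → ℕ)
    (hn : ∀ i, ∃ k, n i = p ^ k) (hne : ∀ i, n i • e i = 0) (S : Multiset G)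
    (hS : 1 + ∑ i, (n i - 1) ≤ S.card) : ∃ T ≤ S, T ≠ 0 ∧ T.sum = 0 := by
  let x : ι → AddMonoidAlgebra (ZMod p) G := fun i => 1 - single (e i) 1
  let I : Ideal (AddMonoidAlgebra (ZMod p) G) := ∑ i, Ideal.span {x i}
  have : CharP (AddMonoidAlgebra (ZMod p) G) p := charP_of_injective_algebraMap' (ZMod p) p
  have hx (i : ι) : x i ^ n i = 0 := by
    obtain ⟨k, hk⟩ := hn i
    have h := hne i
    rw [hk] at h ⊢
    simp [x, sub_pow_char_pow, single_pow, h, one_def]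
  have hI : I ^ (1 + ∑ i, (n i - 1)) = 0 :=
    Finset.univ.sum_pow_eq_zero_of_pow_eq_zero _ n fun i _ => by
      rw [Ideal.span_singleton_pow, hx]; simp
  have hmem (g : G) : 1 - single g (1 : ZMod p) ∈ I := by
    have hle : AddSubmonoid.closure (Set.range e) ≤ augmentationSubmonoid I := by
      rw [AddSubmonoid.closure_le]
      rintro _ ⟨i, rfl⟩
      exact Finset.single_le_sum (f := fun i => Ideal.span {x i}) (fun _ _ => zero_le)
        (Finset.mem_univ i) (Ideal.mem_span_singleton_self (x i))
    exact hle (he ▸ AddSubmonoid.mem_top g)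
  have hprod : (S.map fun h => 1 - single h (1 : ZMod p)).prod = 0 := by
    have h := Multiset.prod_mem_pow_card I (S.map fun h => 1 - single h (1 : ZMod p)) (by
      simp only [Multiset.mem_map]
      rintro _ ⟨g, -, rfl⟩
      exact hmem g)
    rw [Multiset.card_map] at h
    simpa [hI] using Ideal.pow_le_pow_right hS h
  exact exists_sum_eq_of_coeff_prod_sub_one_ne_zero (R := ZMod p) S 0 (by
    rw [hprod]; simp [one_def])

theorem exists_zero_sum_free_card_eq {ι : Type*} [Fintype ι] [DecidableEq ι] (n : ι → ℕ)
    (hn : ∀ i, 0 < n i) : ∃ S : Multiset ((i : ι) → ZMod (n i)),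
      S.card = ∑ i, (n i - 1) ∧ ∀ T ≤ S, T.sum = 0 → T = 0 := by
  let M : Multiset ι := ∑ i, Multiset.replicate (n i - 1) i
  refine ⟨M.map fun i => Pi.single i 1, by simp [M], fun T hT h0 => ?_⟩
  obtain ⟨M', hM, rfl⟩ := Multiset.exists_le_map_eq_of_le_map _ hT
  suffices M' = 0 by simp [this]
  have hsum (N : Multiset ι) (j : ι) :
      (N.map fun i => (Pi.single i 1 : (i : ι) → ZMod (n i))).sum j = N.count j := by
    induction N using Multiset.induction_on with
    | empty => simp
    | cons a N ih =>
      by_cases h : j = a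
      · subst h; simp [ih, add_comm]
      · simp [ih, h]
  ext j
  have hdvd : n j ∣ M'.count j := by
    rw [← ZMod.natCast_eq_zero_iff, ← hsum, h0, Pi.zero_apply]
  have hle : M'.count j ≤ n j - 1 := by
    simpa [M, Multiset.count_sum', Multiset.count_replicate] using Multiset.count_le_of_le j hM
  have := hn j
  simpa using Nat.eq_zero_of_dvd_of_lt hdvd (by omega)

theorem closure_range_pi_single_one {ι : Type*} [Fintype ι] [DecidableEq ι] (n : ι → ℕ)
    [∀ i, NeZero (n i)] :
    AddSubmonoid.closure (Set.range fun i => (Pi.single i 1 : (i : ι) → ZMod (n i))) = ⊤ := by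
  refine eq_top_iff.2 fun g _ => ?_
  have h : g = ∑ i, (g i).val • (Pi.single i 1 : (i : ι) → ZMod (n i)) := by
    conv_lhs => rw [← Finset.univ_sum_single g]
    refine Finset.sum_congr rfl fun i _ => ?_
    rw [← Pi.single_smul]
    simp
  rw [h]
  exact sum_mem fun i _ => nsmul_mem (AddSubmonoid.subset_closure (Set.mem_range_self i)) _

end

/-- For a finite abelian `p`-group `G ≅ C_{n₁} ⊕ ⋯ ⊕ C_{n_r}` with
`1 < n₁ ∣ ⋯ ∣ n_r`, we have `D(G) = 1 + Σᵢ (nᵢ − 1)`. -/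
theorem stmt12 (p : ℕ) (hp : p.Prime) (G : Type*) [AddCommGroup G] [Finite G]
    (hpG : ∀ g : G, ∃ k : ℕ, p ^ k • g = 0)
    (r : ℕ) (n : Fin r → ℕ) (hn : ∀ i, 1 < n i)
    (hdvd : ∀ i j : Fin r, i ≤ j → n i ∣ n j)
    (hiso : Nonempty (G ≃+ ((i : Fin r) → ZMod (n i)))) :
    davenport G = 1 + ∑ i : Fin r, (n i - 1) := by
  classical
  obtain ⟨φ⟩ := hiso
  have : Fact p.Prime := ⟨hp⟩
  have hne (i : Fin r) : NeZero (n i) := ⟨(zero_lt_one.trans (hn i)).ne'⟩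
  have hpow (i : Fin r) : ∃ k, n i = p ^ k := by
    obtain ⟨k, hk⟩ := hpG (φ.symm (Pi.single i 1))
    have h := congrFun (congrArg φ hk) i
    have hdvd : n i ∣ p ^ k := by
      rw [← ZMod.natCast_eq_zero_iff]
      simpa using h
    obtain ⟨m, -, hm⟩ := (Nat.dvd_prime_pow hp).1 hdvd
    exact ⟨m, hm⟩
  refine IsLeast.csInf_eq ⟨⟨by omega, fun S hS => ?_⟩, fun ℓ hℓ => ?_⟩
  · obtain ⟨T, hT, hT0, hs⟩ := exists_zero_sum_of_closure_eq_top (p := p) _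
      (closure_range_pi_single_one n) n hpow
      (fun i => by rw [← Pi.single_smul]; simp) (S.map φ) (by simpa using hS)
    obtain ⟨T, hTS, rfl⟩ := Multiset.exists_le_map_eq_of_le_map φ hT
    have hT0 : T ≠ 0 := fun h => hT0 (by simp [h])
    exact ⟨T, hTS, hT0, φ.injective (by simpa [map_multiset_sum] using hs),
      Multiset.card_pos.2 hT0⟩
  · obtain ⟨S, hS, hfree⟩ := exists_zero_sum_free_card_eq n fun i => zero_lt_one.trans (hn i)
    by_contra! hlt
    obtain ⟨T, hT, hT0, hs, -⟩ := hℓ.2 (S.map φ.symm) (by rw [Multiset.card_map]; omega)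
    obtain ⟨T, hTS, rfl⟩ := Multiset.exists_le_map_eq_of_le_map φ.symm hT
    refine hT0 ?_
    rw [hfree T hTS (φ.symm.injective (by simpa [map_multiset_sum] using hs))]
    simp
end

section
/- Let p be a prime, let G be a finite abelian p-group with Davenport constant D(G) ≤ 2·exp(G) − 1, and let a be a positive integer not divisible by p. Write G ≅ C_{n₁} ⊕ ⋯ ⊕ C_{n_r} with 1 < n₁ ∣ ⋯ ∣ n_r. Then the group G' = C_a ⊕ G satisfies D(G') = D(G) + (a − 1)·exp(G); in particular D(G') equals 1 + (a·n_r − 1) + Σ_{i=1}^{r−1}(n_i − 1) when a > 1. -/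
/-- A sequence is zero-sum free if it has no nonempty zero-sum subsequence. -/
def ZeroSumFree {G : Type*} [AddCommGroup G] (S : Multiset G) : Prop :=
  ∀ T ≤ S, T.sum = 0 → T = 0

theorem not_zeroSumFree_iff {G : Type*} [AddCommGroup G] {S : Multiset G} :
    ¬ ZeroSumFree S ↔ ∃ T ≤ S, T ≠ 0 ∧ T.sum = 0 := by
  simp only [ZeroSumFree]
  push Not
  exact ⟨fun ⟨T, h1, h2, h3⟩ => ⟨T, h1, h3, h2⟩, fun ⟨T, h1, h2, h3⟩ => ⟨T, h1, h3, h2⟩⟩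

theorem davenport_eq_card_add_one {G : Type*} [AddCommGroup G] {S₀ : Multiset G}
    (hS₀ : ZeroSumFree S₀)
    (h : ∀ S : Multiset G, Multiset.card S₀ + 1 ≤ Multiset.card S → ¬ ZeroSumFree S) :
    davenport G = Multiset.card S₀ + 1 := by
  have hmem : Multiset.card S₀ + 1 ∈ {ℓ : ℕ | 0 < ℓ ∧ ∀ S : Multiset G, ℓ ≤ Multiset.card S →
      ∃ T : Multiset G, T ≤ S ∧ T ≠ 0 ∧ T.sum = 0 ∧ Multiset.card T ∈ {t | 0 < t}} := by
    refine ⟨Nat.succ_pos _, fun S hS => ?_⟩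
    obtain ⟨T, hT, hT0, hsum⟩ := not_zeroSumFree_iff.1 (h S hS)
    exact ⟨T, hT, hT0, hsum, Multiset.card_pos.2 hT0⟩
  refine le_antisymm (Nat.sInf_le hmem) ?_
  by_contra! hlt
  obtain ⟨T, hT, hT0, hsum, -⟩ := (Nat.sInf_mem ⟨_, hmem⟩).2 S₀ (Nat.le_of_lt_succ hlt)
  exact hT0 (hS₀ T hT hsum)

theorem Multiset.exists_le_map_eq_of_le_map_s13 {α β : Type*} {f : α → β} {S : Multiset α} :
    ∀ {T : Multiset β}, T ≤ S.map f → ∃ U ≤ S, U.map f = T := by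
  classical
  induction S using Multiset.induction_on with
  | empty => intro T hT; exact ⟨0, le_rfl, (by simpa using hT : T = 0).symm⟩
  | cons a S ih =>
    intro T hT
    rw [Multiset.map_cons] at hT
    by_cases ha : f a ∈ T
    · obtain ⟨T, rfl⟩ := Multiset.exists_cons_of_mem ha
      obtain ⟨U, hU, rfl⟩ := ih ((Multiset.cons_le_cons_iff _).1 hT)
      exact ⟨a ::ₘ U, Multiset.cons_le_cons _ hU, by simp⟩
    · obtain ⟨U, hU, rfl⟩ := ih ((Multiset.le_cons_of_notMem ha).1 hT)
      exact ⟨U, hU.trans (Multiset.le_cons_self _ _), rfl⟩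

theorem Multiset.exists_le_card_eq {α : Type*} {S : Multiset α} {k : ℕ}
    (h : k ≤ Multiset.card S) : ∃ T ≤ S, Multiset.card T = k := by
  induction S using Quotient.inductionOn with
  | h l => exact ⟨(l.take k : Multiset α), (List.take_sublist k l).subperm, by simpa using h⟩

/-- A family of elements that is independent with orders `N i` gives a zero-sum free sequence. -/
theorem exists_zeroSumFree_of_independent {ι H : Type*} [Fintype ι] [AddCommGroup H]
    (e : ι → H) (N : ι → ℕ) (hN : ∀ i, 0 < N i)
    (hind : ∀ t : ι → ℕ, ∑ i, t i • e i = 0 → ∀ i, N i ∣ t i) :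
    ∃ S : Multiset H, ZeroSumFree S ∧ Multiset.card S = ∑ i, (N i - 1) := by
  classical
  refine ⟨(∑ i, Multiset.replicate (N i - 1) i).map e, fun T hT hsum => ?_, by simp⟩
  obtain ⟨U, hU, rfl⟩ := Multiset.exists_le_map_eq_of_le_map_s13 hT
  have hcount : ∀ i, U.count i ≤ N i - 1 := fun i => by
    have h := Multiset.le_iff_count.1 hU i
    simpa [Multiset.count_sum', Multiset.count_replicate] using h
  have hdvd := hind (fun i => U.count i) (by
    rw [← hsum, Finset.sum_multiset_map_count]
    refine (Finset.sum_subset (Finset.subset_univ _) fun i _ hi => ?_).symm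
    rw [Multiset.mem_toFinset] at hi
    simp [Multiset.count_eq_zero_of_notMem hi])
  have hU0 : U = 0 := Multiset.ext.2 fun i => by
    rw [Multiset.count_zero]
    exact Nat.eq_zero_of_dvd_of_lt (hdvd i) (by have := hcount i; have := hN i; omega)
  simp [hU0]

theorem Ideal.sup_pow_add_add_one_le {R : Type*} [CommRing R] (I J : Ideal R) (n m : ℕ) :
    (I ⊔ J) ^ (n + m + 1) ≤ I ^ (n + 1) ⊔ J ^ (m + 1) := by
  rw [← Ideal.add_eq_sup, ← Ideal.add_eq_sup, add_pow, Ideal.sum_eq_sup]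
  refine Finset.sup_le fun i _ => ?_
  by_cases hn : n + 1 ≤ i
  · exact (Ideal.mul_le_left.trans (Ideal.mul_le_left.trans
      ((Ideal.pow_le_pow_right hn).trans le_sup_left)))
  · refine (Ideal.mul_le_left.trans (Ideal.mul_le_right.trans
      ((Ideal.pow_le_pow_right ?_).trans le_sup_right)))
    lia

theorem Ideal.sup_span_singleton_pow_eq_bot {R ι : Type*} [CommRing R] (s : Finset ι) (x : ι → R)
    (m : ι → ℕ) (hx : ∀ i, x i ^ (m i + 1) = 0) :
    (s.sup fun i => Ideal.span {x i}) ^ (∑ i ∈ s, m i + 1) = ⊥ := by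
  classical
  induction s using Finset.induction_on with
  | empty => simp
  | insert i s hi ih =>
    rw [Finset.sup_insert, Finset.sum_insert hi, eq_bot_iff]
    refine (Ideal.sup_pow_add_add_one_le _ _ _ _).trans ?_
    rw [ih, Ideal.span_singleton_pow, hx]
    simp

theorem Ideal.multiset_prod_mem_pow {R : Type*} [CommRing R] {I : Ideal R} (S : Multiset R)
    (hS : ∀ x ∈ S, x ∈ I) : S.prod ∈ I ^ Multiset.card S := by
  induction S using Multiset.induction_on with
  | empty => simp
  | cons a S ih =>
    rw [Multiset.prod_cons, Multiset.card_cons, pow_succ']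
    exact Ideal.mul_mem_mul (hS a (Multiset.mem_cons_self _ _))
      (ih fun x hx => hS x (Multiset.mem_cons_of_mem hx))

open AddMonoidAlgebra in
theorem AddMonoidAlgebra.one_sub_single_mem {k H : Type*} [CommRing k] [AddCommGroup H]
    (s : Set H) (I : Ideal (AddMonoidAlgebra k H)) (hs : ∀ g ∈ s, 1 - single g (1 : k) ∈ I) {g : H}
    (hg : g ∈ AddSubmonoid.closure s) : 1 - single g (1 : k) ∈ I := by
  induction hg using AddSubmonoid.closure_induction with
  | mem x hx => exact hs x hx
  | zero => simp [AddMonoidAlgebra.one_def]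
  | add x y _ _ hx hy =>
    have h : (1 - single (x + y) (1 : k) : AddMonoidAlgebra k H) =
        (1 - single x 1) + single x 1 * (1 - single y 1) := by
      rw [mul_sub, AddMonoidAlgebra.single_mul_single]
      simp
    rw [h]
    exact I.add_mem hx (I.mul_mem_left _ hy)

open AddMonoidAlgebra in
theorem AddMonoidAlgebra.prod_one_sub_single {k H : Type*} [CommRing k] [AddCommGroup H]
    (S : Multiset H) : ∃ q : AddMonoidAlgebra k H,
      (S.map fun g => 1 - single g (1 : k)).prod = 1 + q ∧
      ∀ g, q.coeff g ≠ 0 → ∃ T ≤ S, T ≠ 0 ∧ T.sum = g := by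
  classical
  induction S using Multiset.induction_on with
  | empty => exact ⟨0, by simp, by simp⟩
  | cons a S ih =>
    obtain ⟨q, hq, hsupp⟩ := ih
    refine ⟨q - single a 1 - single a 1 * q, by rw [Multiset.map_cons, Multiset.prod_cons, hq]; ring,
      fun g hg => ?_⟩
    by_cases h1 : q.coeff g = 0
    · by_cases h2 : a = g
      · exact ⟨{a}, by simp, by simp, by simpa using h2⟩
      · have h3 : q.coeff (-a + g) ≠ 0 := by
          intro h3
          apply hg
          simp [h1, h3, AddMonoidAlgebra.coeff_single_mul_apply, h2]
        obtain ⟨T, hT, hT0, hsum⟩ := hsupp _ h3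
        exact ⟨a ::ₘ T, Multiset.cons_le_cons _ hT, by simp, by simp [hsum]⟩
    · obtain ⟨T, hT, hT0, hsum⟩ := hsupp _ h1
      exact ⟨T, hT.trans (Multiset.le_cons_self _ _), hT0, hsum⟩

/-- Olson's upper bound for the Davenport constant of a finite abelian `p`-group. -/
theorem not_zeroSumFree_of_closure_eq_top {p : ℕ} (hp : p.Prime) {ι H : Type*} [Fintype ι]
    [AddCommGroup H] (e : ι → H) (k : ι → ℕ) (he : ∀ i, p ^ k i • e i = 0)
    (hgen : AddSubmonoid.closure (Set.range e) = ⊤) (S : Multiset H)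
    (hS : ∑ i, (p ^ k i - 1) + 1 ≤ Multiset.card S) : ¬ ZeroSumFree S := by
  have : Fact p.Prime := ⟨hp⟩
  have : CharP (AddMonoidAlgebra (ZMod p) H) p :=
    charP_of_injective_algebraMap (algebraMap (ZMod p) _).injective p
  set x : ι → AddMonoidAlgebra (ZMod p) H := fun i => 1 - AddMonoidAlgebra.single (e i) 1 with hx
  have hpow : ∀ i, x i ^ (p ^ k i - 1 + 1) = 0 := fun i => by
    rw [Nat.sub_add_cancel (Nat.pos_of_ne_zero (pow_ne_zero _ hp.ne_zero)), hx]
    simp only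
    rw [sub_pow_char_pow, AddMonoidAlgebra.single_pow, he]
    simp [AddMonoidAlgebra.one_def]
  have hbot := Ideal.sup_span_singleton_pow_eq_bot Finset.univ x (fun i => p ^ k i - 1) hpow
  set I := Finset.univ.sup fun i => Ideal.span {x i}
  have hmem : ∀ g : H, 1 - AddMonoidAlgebra.single g (1 : ZMod p) ∈ I := fun g => by
    refine AddMonoidAlgebra.one_sub_single_mem (Set.range e) I ?_ (hgen ▸ AddSubmonoid.mem_top g)
    rintro _ ⟨i, rfl⟩
    exact Finset.le_sup (f := fun i => Ideal.span {x i}) (Finset.mem_univ i)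
      (Ideal.mem_span_singleton_self _)
  obtain ⟨q, hq, hsupp⟩ := AddMonoidAlgebra.prod_one_sub_single (k := ZMod p) S
  have hzero : (S.map fun g => 1 - AddMonoidAlgebra.single g (1 : ZMod p)).prod = 0 := by
    have h := Ideal.multiset_prod_mem_pow (I := I)
      (S.map fun g => 1 - AddMonoidAlgebra.single g (1 : ZMod p)) (by simpa using fun g _ => hmem g)
    rw [Multiset.card_map] at h
    simpa [hbot] using Ideal.pow_le_pow_right hS h
  rw [not_zeroSumFree_iff]
  refine hsupp 0 fun h0 => ?_
  have h := congrArg (fun f => f.coeff 0) (hq.symm.trans hzero)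
  simp [h0, AddMonoidAlgebra.one_def] at h

/-- If `D(G) ≤ 2n - 1` and `D(G ⊕ C_n) ≤ D(G) + n - 1`, then `η(G) ≤ D(G) + n - 1`. -/
theorem exists_short_zeroSum {G : Type*} [AddCommGroup G] {d n : ℕ}
    (hd : d + 1 ≤ 2 * n - 1) (hG : ∀ S : Multiset G, d + 1 ≤ Multiset.card S → ¬ ZeroSumFree S)
    (hGn : ∀ S : Multiset (G × ZMod n), d + n ≤ Multiset.card S → ¬ ZeroSumFree S)
    (S : Multiset G) (hS : d + n ≤ Multiset.card S) :
    ∃ T ≤ S, T ≠ 0 ∧ T.sum = 0 ∧ Multiset.card T ≤ n := by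
  classical
  obtain ⟨S₀, hS₀, hcard⟩ := Multiset.exists_le_card_eq hS
  obtain ⟨T', hT', hT'0, hT'sum⟩ := not_zeroSumFree_iff.1
    (hGn (S₀.map fun g => (g, (1 : ZMod n))) (by simp [hcard]))
  obtain ⟨T, hT, rfl⟩ := Multiset.exists_le_map_eq_of_le_map_s13 hT'
  have hT0 : T ≠ 0 := by rintro rfl; simp at hT'0
  have hsum : T.sum = 0 := by
    simpa [Multiset.map_map, map_multiset_sum] using congrArg (AddMonoidHom.fst G (ZMod n)) hT'sum
  have hdvd : n ∣ Multiset.card T := by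
    rw [← ZMod.natCast_eq_zero_iff]
    simpa [Multiset.map_map, map_multiset_sum] using congrArg (AddMonoidHom.snd G (ZMod n)) hT'sum
  have hpos := Multiset.card_pos.2 hT0
  have hle := Multiset.card_le_card hT
  obtain ⟨c, hc⟩ := hdvd
  have hc3 : c < 3 := by
    by_contra! h
    have := Nat.mul_le_mul_left n h
    omega
  by_cases hcn : Multiset.card T ≤ n
  · exact ⟨T, hT.trans hS₀, hT0, hsum, hcn⟩
  have hc2 : c = 2 := by interval_cases c <;> omega
  subst hc2
  obtain ⟨V, hV, hVcard⟩ := Multiset.exists_le_card_eq (S := T) (k := d + 1) (by omega)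
  obtain ⟨U, hU, hU0, hUsum⟩ := not_zeroSumFree_iff.1 (hG V hVcard.ge)
  have hUcard := Multiset.card_le_card hU
  have hUT := hU.trans hV
  by_cases hUn : Multiset.card U ≤ n
  · exact ⟨U, hUT.trans (hT.trans hS₀), hU0, hUsum, hUn⟩
  · have hsub := Multiset.card_sub hUT
    refine ⟨T - U, (Multiset.sub_le_self _ _).trans (hT.trans hS₀), ?_, ?_, by omega⟩
    · rw [← Multiset.card_pos]; omega
    · have h := congrArg Multiset.sum (Multiset.sub_add_cancel hUT)
      rwa [Multiset.sum_add, hUsum, hsum, add_zero] at h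

theorem exists_disjoint_zeroSum {α G : Type*} [AddCommGroup G] {d n : ℕ} (f : α → G)
    (hG : ∀ S : Multiset G, d + 1 ≤ Multiset.card S → ¬ ZeroSumFree S)
    (hshort : ∀ S : Multiset G, d + n ≤ Multiset.card S →
      ∃ T ≤ S, T ≠ 0 ∧ T.sum = 0 ∧ Multiset.card T ≤ n) (j : ℕ) :
    ∀ S : Multiset α, d + 1 + j * n ≤ Multiset.card S →
      ∃ B : Multiset (Multiset α), B.sum ≤ S ∧ Multiset.card B = j + 1 ∧
        ∀ T ∈ B, T ≠ 0 ∧ (T.map f).sum = 0 := by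
  classical
  induction j with
  | zero =>
    intro S hS
    obtain ⟨T, hT, hT0, hsum⟩ := not_zeroSumFree_iff.1 (hG (S.map f) (by simpa using hS))
    obtain ⟨U, hU, rfl⟩ := Multiset.exists_le_map_eq_of_le_map_s13 hT
    exact ⟨{U}, by simpa using hU, by simp, by simpa using ⟨by simpa using hT0, hsum⟩⟩
  | succ j ih =>
    intro S hS
    rw [add_one_mul] at hS
    by_cases hn : n = 0
    · obtain ⟨T, -, hT0, -, hcard⟩ := hshort (S.map f) (by rw [Multiset.card_map]; omega)
      exact absurd (Multiset.card_pos.2 hT0) (by omega)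
    obtain ⟨T, hT, hT0, hsum, hcard⟩ := hshort (S.map f) (by rw [Multiset.card_map]; omega)
    obtain ⟨U, hU, rfl⟩ := Multiset.exists_le_map_eq_of_le_map_s13 hT
    rw [Multiset.card_map] at hcard
    have hsub := Multiset.card_sub hU
    obtain ⟨B, hB, hBcard, hBmem⟩ := ih (S - U) (by omega)
    refine ⟨U ::ₘ B, ?_, by simp [hBcard], ?_⟩
    · rw [Multiset.sum_cons, add_comm]
      exact (add_le_add_left hB U).trans_eq (Multiset.sub_add_cancel hU)
    · simp only [Multiset.mem_cons, forall_eq_or_imp]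
      exact ⟨⟨by simpa using hT0, hsum⟩, hBmem⟩

theorem ZMod.not_zeroSumFree {a : ℕ} (ha : 0 < a) (S : Multiset (ZMod a))
    (hS : a ≤ Multiset.card S) : ¬ ZeroSumFree S := by
  classical
  have : NeZero a := ⟨ha.ne'⟩
  obtain ⟨T, hT, hcard, hsum⟩ := ZMod.erdos_ginzburg_ziv_multiset
    (S + Multiset.replicate (a - 1) 0) (by simp; omega)
  set Z : Multiset (ZMod a) := Multiset.replicate (a - 1) 0
  have hsplit := Multiset.sub_add_inter T Z
  have hZ : (T ∩ Z).sum = 0 := Multiset.sum_eq_zero fun x hx =>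
    Multiset.eq_of_mem_replicate (Multiset.mem_of_le (Multiset.inter_le_right) hx)
  have hZcard : Multiset.card (T ∩ Z) ≤ a - 1 := by
    simpa only [Z, Multiset.card_replicate] using
      Multiset.card_le_card (Multiset.inter_le_right (s := T) (t := Z))
  rw [not_zeroSumFree_iff]
  refine ⟨T - Z, Multiset.sub_le_iff_le_add.2 hT, ?_, ?_⟩
  · rw [← Multiset.card_pos]
    have := congrArg Multiset.card hsplit
    rw [Multiset.card_add] at this
    omega
  · rw [← hsum, ← hsplit, Multiset.sum_add, hZ, add_zero, hsplit]

theorem AddMonoidHom.map_sum_multiset_sum {G H : Type*} [AddCommMonoid G] [AddCommMonoid H]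
    (φ : G →+ H) (C : Multiset (Multiset G)) :
    φ C.sum.sum = (C.map fun U => (U.map φ).sum).sum := by
  induction C using Multiset.induction_on with
  | empty => simp
  | cons U C ih => simp [ih, map_multiset_sum]

theorem not_zeroSumFree_prod {G : Type*} [AddCommGroup G] {a d n : ℕ} (ha : 0 < a)
    (hG : ∀ S : Multiset G, d + 1 ≤ Multiset.card S → ¬ ZeroSumFree S)
    (hshort : ∀ S : Multiset G, d + n ≤ Multiset.card S →
      ∃ T ≤ S, T ≠ 0 ∧ T.sum = 0 ∧ Multiset.card T ≤ n)
    (S : Multiset (ZMod a × G)) (hS : d + 1 + (a - 1) * n ≤ Multiset.card S) :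
    ¬ ZeroSumFree S := by
  classical
  obtain ⟨B, hB, hBcard, hBmem⟩ := exists_disjoint_zeroSum Prod.snd hG hshort (a - 1) S hS
  obtain ⟨T, hT, hT0, hTsum⟩ := not_zeroSumFree_iff.1 (ZMod.not_zeroSumFree ha
    (B.map fun U => (U.map Prod.fst).sum) (by rw [Multiset.card_map]; omega))
  obtain ⟨C, hC, rfl⟩ := Multiset.exists_le_map_eq_of_le_map_s13 hT
  obtain ⟨E, rfl⟩ := Multiset.le_iff_exists_add.1 hC
  rw [not_zeroSumFree_iff]
  refine ⟨C.sum, ?_, ?_, ?_⟩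
  · rw [Multiset.sum_add] at hB
    exact (Multiset.le_add_right _ _).trans hB
  · obtain ⟨U, hU⟩ := Multiset.exists_mem_of_ne_zero (s := C) (by simpa using hT0)
    obtain ⟨C', rfl⟩ := Multiset.exists_cons_of_mem hU
    have := (hBmem U (by simp)).1
    simp [this]
  · ext1
    · rw [← AddMonoidHom.coe_fst, AddMonoidHom.map_sum_multiset_sum]
      exact hTsum
    · rw [← AddMonoidHom.coe_snd, AddMonoidHom.map_sum_multiset_sum]
      refine Multiset.sum_eq_zero fun x hx => ?_
      obtain ⟨U, hU, rfl⟩ := Multiset.mem_map.1 hx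
      exact (hBmem U (Multiset.mem_of_le hC hU)).2

section Pi

variable {ι : Type*} {G : Type*} [AddCommGroup G] {n : ι → ℕ}

theorem map_sum_nsmul_symm_single [Fintype ι] [DecidableEq ι] (φ : G ≃+ ((i : ι) → ZMod (n i)))
    (t : ι → ℕ) : φ (∑ i, t i • φ.symm (Pi.single i 1)) = fun i => (t i : ZMod (n i)) := by
  rw [map_sum, ← Finset.univ_sum_single fun i => (t i : ZMod (n i))]
  refine Finset.sum_congr rfl fun i _ => ?_
  rw [map_nsmul, AddEquiv.apply_symm_apply, ← Pi.single_smul, nsmul_one]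

theorem dvd_of_sum_nsmul_symm_single_eq_zero [Fintype ι] [DecidableEq ι]
    (φ : G ≃+ ((i : ι) → ZMod (n i))) (t : ι → ℕ)
    (h : ∑ i, t i • φ.symm (Pi.single i 1) = 0) (i : ι) : n i ∣ t i := by
  rw [← ZMod.natCast_eq_zero_iff]
  rw [← congrFun (map_sum_nsmul_symm_single φ t) i, h, map_zero, Pi.zero_apply]

theorem closure_range_symm_single_eq_top [Fintype ι] [DecidableEq ι]
    (φ : G ≃+ ((i : ι) → ZMod (n i))) (hn : ∀ i, n i ≠ 0) :
    AddSubmonoid.closure (Set.range fun i => φ.symm (Pi.single i 1)) = ⊤ := by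
  have : ∀ i, NeZero (n i) := fun i => ⟨hn i⟩
  refine eq_top_iff.2 fun g _ => ?_
  have hg : g = ∑ i, (φ g i).val • φ.symm (Pi.single i 1) := by
    apply φ.injective
    rw [map_sum_nsmul_symm_single φ fun i => (φ g i).val]
    simp
  rw [hg]
  exact sum_mem fun i _ => nsmul_mem (AddSubmonoid.subset_closure (Set.mem_range_self i)) _

theorem nsmul_symm_single_eq_zero [DecidableEq ι] (φ : G ≃+ ((i : ι) → ZMod (n i))) (i : ι) :
    n i • φ.symm (Pi.single i 1) = 0 := by
  rw [← map_nsmul, ← Pi.single_smul]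
  simp

theorem exists_eq_prime_pow [DecidableEq ι] {p : ℕ} (hp : p.Prime)
    (hpG : ∀ g : G, ∃ k : ℕ, p ^ k • g = 0) (φ : G ≃+ ((i : ι) → ZMod (n i))) : ∃ k : ι → ℕ, n = fun i => p ^ k i := by
  have h : ∀ i, ∃ k, n i = p ^ k := fun i => by
    obtain ⟨k, hk⟩ := hpG (φ.symm (Pi.single i 1))
    have hdvd : n i ∣ p ^ k := by
      rw [← ZMod.natCast_eq_zero_iff]
      have h' := congrFun (congrArg φ hk) i
      simpa using h'
    obtain ⟨l, -, hl⟩ := (Nat.dvd_prime_pow hp).1 hdvd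
    exact ⟨l, hl⟩
  choose k hk using h
  exact ⟨k, funext hk⟩

/-- Olson's theorem: `D(G) = 1 + ∑ (nᵢ - 1)` for a finite abelian `p`-group. -/
theorem davenport_eq_of_equiv_pi [Fintype ι] {p : ℕ} (hp : p.Prime) {k : ι → ℕ}
    (φ : G ≃+ ((i : ι) → ZMod (p ^ k i))) : davenport G = ∑ i, (p ^ k i - 1) + 1 := by
  classical
  obtain ⟨S, hS, hcard⟩ := exists_zeroSumFree_of_independent (fun i => φ.symm (Pi.single i 1))
    (fun i => p ^ k i) (fun i => pow_pos hp.pos _) (dvd_of_sum_nsmul_symm_single_eq_zero φ)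
  rw [← hcard]
  refine davenport_eq_card_add_one hS fun T hT => ?_
  rw [hcard] at hT
  exact not_zeroSumFree_of_closure_eq_top hp _ k (nsmul_symm_single_eq_zero φ)
    (closure_range_symm_single_eq_top φ fun i => pow_ne_zero _ hp.ne_zero) T hT

theorem not_zeroSumFree_prod_of_davenport_le [Fintype ι] {p : ℕ} (hp : p.Prime) {k : ι → ℕ}
    (φ : G ≃+ ((i : ι) → ZMod (p ^ k i))) {K a : ℕ} (ha : 0 < a)
    (hD : davenport G ≤ 2 * p ^ K - 1) (S : Multiset (ZMod a × G))
    (hS : ∑ i, (p ^ k i - 1) + 1 + (a - 1) * p ^ K ≤ Multiset.card S) : ¬ ZeroSumFree S := by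
  classical
  have hpos : 0 < p ^ K := pow_pos hp.pos _
  have hgen := closure_range_symm_single_eq_top φ fun i => pow_ne_zero _ hp.ne_zero
  have hG := not_zeroSumFree_of_closure_eq_top hp _ k (nsmul_symm_single_eq_zero φ) hgen
  rw [davenport_eq_of_equiv_pi hp φ] at hD
  refine not_zeroSumFree_prod ha hG (exists_short_zeroSum hD hG fun T hT => ?_) S hS
  let ψ : G × ZMod (p ^ K) ≃+
      ((i : Option ι) → ZMod (p ^ (i.elim K k : ℕ))) :=
    { toFun := fun x i => match i with
        | none => x.2
        | some i => φ x.1 i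
      invFun := fun y => (φ.symm fun i => y (some i), y none)
      left_inv := fun x => by simp
      right_inv := fun y => by
        ext i
        cases i with
        | none => rfl
        | some i => exact congrFun (φ.apply_symm_apply fun i => y (some i)) i
      map_add' := fun x y => by ext i; cases i <;> simp <;> rfl }
  refine not_zeroSumFree_of_closure_eq_top hp _ _ (nsmul_symm_single_eq_zero ψ)
    (closure_range_symm_single_eq_top ψ fun i => pow_ne_zero _ hp.ne_zero) T ?_
  rw [Fintype.sum_option]
  simp only [Option.elim_none, Option.elim_some]
  omega

theorem exists_zeroSumFree_prod [Fintype ι] (φ : G ≃+ ((i : ι) → ZMod (n i)))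
    (hn : ∀ i, 0 < n i) {a : ℕ} (ha : 0 < a) (j : ι) (hcop : a.Coprime (n j)) :
    ∃ S : Multiset (ZMod a × G), ZeroSumFree S ∧
      Multiset.card S = ∑ i, (n i - 1) + (a - 1) * n j := by
  classical
  obtain ⟨S, hS, hcard⟩ := exists_zeroSumFree_of_independent
    (fun i => ((if i = j then 1 else 0 : ZMod a), φ.symm (Pi.single i 1)))
    (fun i => if i = j then a * n i else n i)
    (fun i => by split_ifs; exacts [Nat.mul_pos ha (hn i), hn i])
    (fun t ht i => by
      have h2 := dvd_of_sum_nsmul_symm_single_eq_zero φ t (by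
        simpa [Prod.snd_sum] using congrArg Prod.snd ht)
      split_ifs with hij
      · subst hij
        refine hcop.mul_dvd_of_dvd_of_dvd ?_ (h2 i)
        rw [← ZMod.natCast_eq_zero_iff]
        simpa [Prod.fst_sum] using congrArg Prod.fst ht
      · exact h2 i)
  refine ⟨S, hS, hcard.trans ?_⟩
  rw [← Finset.add_sum_erase _ _ (Finset.mem_univ j),
    ← Finset.add_sum_erase _ (fun i => n i - 1) (Finset.mem_univ j)]
  rw [Finset.sum_congr rfl fun i hi => by rw [if_neg (Finset.ne_of_mem_erase hi)]]
  obtain ⟨b, rfl⟩ := Nat.exists_eq_add_of_lt ha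
  have := hn j
  simp only [if_true, zero_add, Nat.add_sub_cancel, add_one_mul]
  omega

end Pi

theorem exists_zeroSumFree_zmod_prod {a : ℕ} (G : Type*) [AddCommGroup G] :
    ∃ S : Multiset (ZMod a × G), ZeroSumFree S ∧ Multiset.card S = a - 1 := by
  rcases Nat.eq_zero_or_pos a with rfl | ha
  · exact ⟨0, fun T hT _ => by simpa using hT, rfl⟩
  obtain ⟨S, hS, hcard⟩ := exists_zeroSumFree_of_independent
    (fun _ : Unit => ((1, 0) : ZMod a × G)) (fun _ => a) (fun _ => ha) (fun t ht i => by
      rw [← ZMod.natCast_eq_zero_iff]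
      simpa using congrArg Prod.fst ht)
  exact ⟨S, hS, by simpa using hcard⟩

theorem exponent_eq_last {G : Type*} [AddCommGroup G] {r : ℕ} {n : Fin (r + 1) → ℕ}
    (hdvd : ∀ i j, i ≤ j → n i ∣ n j) (φ : G ≃+ ((i : Fin (r + 1)) → ZMod (n i))) :
    AddMonoid.exponent G = n (Fin.last r) := by
  rw [AddMonoid.exponent_eq_of_addEquiv φ, AddMonoid.exponent_pi]
  simp only [ZMod.exponent]
  exact dvd_antisymm (Finset.lcm_dvd fun i _ => hdvd i _ (Fin.le_last i))
    (Finset.dvd_lcm (Finset.mem_univ _))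

/-- Let `G` be a finite abelian `p`-group with `D(G) ≤ 2·exp(G) − 1`,
written `G ≅ C_{n₁} ⊕ ⋯ ⊕ C_{n_r}` with `1 < n₁ ∣ ⋯ ∣ n_r`, and let `a` be a positive
integer not divisible by `p`. Then `G' = C_a ⊕ G` satisfies
`D(G') = D(G) + (a − 1)·exp(G)`; in particular, when `a > 1` (and `r ≥ 1`),
`D(G') = 1 + (a·n_r − 1) + Σ_{i=1}^{r−1} (nᵢ − 1)`. -/
theorem stmt13 (p : ℕ) (hp : p.Prime) (G : Type*) [AddCommGroup G] [Finite G]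
    (hpG : ∀ g : G, ∃ k : ℕ, p ^ k • g = 0)
    (hD : davenport G ≤ 2 * AddMonoid.exponent G - 1)
    (r : ℕ) (n : Fin r → ℕ) (hn : ∀ i, 1 < n i)
    (hdvd : ∀ i j : Fin r, i ≤ j → n i ∣ n j)
    (hiso : Nonempty (G ≃+ ((i : Fin r) → ZMod (n i))))
    (a : ℕ) (ha : 0 < a) (hpa : ¬ p ∣ a) :
    davenport (ZMod a × G) = davenport G + (a - 1) * AddMonoid.exponent G ∧
      (1 < a → ∀ hr : 0 < r,
        davenport (ZMod a × G) =
          1 + (a * n ⟨r - 1, Nat.sub_lt hr one_pos⟩ - 1) +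
            ∑ i : Fin (r - 1), (n (Fin.castLE (Nat.sub_le r 1) i) - 1)) := by
  obtain ⟨φ⟩ := hiso
  obtain ⟨k, rfl⟩ := exists_eq_prime_pow hp hpG φ
  cases r with
  | zero =>
    have : Subsingleton G := φ.toEquiv.subsingleton
    have hexp : AddMonoid.exponent G = p ^ 0 := by
      rw [pow_zero]; exact AddMonoid.exp_eq_one_iff.2 this
    rw [hexp] at hD ⊢
    obtain ⟨S, hS, hcard⟩ := exists_zeroSumFree_zmod_prod (a := a) G
    refine ⟨?_, fun _ hr => absurd hr (lt_irrefl 0)⟩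
    rw [davenport_eq_card_add_one hS fun T hT =>
      not_zeroSumFree_prod_of_davenport_le hp φ ha hD T (by simp; omega),
      davenport_eq_of_equiv_pi hp φ, hcard]
    simp [add_comm]
  | succ r =>
    rw [exponent_eq_last hdvd φ] at hD ⊢
    obtain ⟨S, hS, hcard⟩ := exists_zeroSumFree_prod φ (fun i => pow_pos hp.pos _) ha (Fin.last r)
      (Nat.Coprime.pow_right _ ((Nat.Prime.coprime_iff_not_dvd hp).2 hpa).symm)
    have hD' : davenport (ZMod a × G) =
        ∑ i, (p ^ k i - 1) + (a - 1) * p ^ k (Fin.last r) + 1 := by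
      rw [← hcard]
      exact davenport_eq_card_add_one hS fun T hT =>
        not_zeroSumFree_prod_of_davenport_le hp φ ha hD T (by omega)
    refine ⟨?_, fun _ _ => ?_⟩
    · rw [hD', davenport_eq_of_equiv_pi hp φ]
      omega
    · rw [hD', Fin.sum_univ_castSucc]
      change _ = 1 + (a * p ^ k (Fin.last r) - 1) + ∑ i : Fin r, (p ^ k i.castSucc - 1)
      have hpos : 0 < p ^ k (Fin.last r) := pow_pos hp.pos _
      obtain ⟨b, rfl⟩ := Nat.exists_eq_add_of_lt ha
      simp only [zero_add, Nat.add_sub_cancel, add_one_mul]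
      omega
end
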